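/- For A, B ∈ D(N), in the quotient ring R(N_{k,2n}) = ℂ[M_{k,2n}]/I, the product δ_A δ_B (mod I) can be expressed as a ℂ-linear combination δ_A δ_B = Σ_r c_r δ_{X_r} δ_{Y_r} of images of N-standard monomials with X_r, Y_r ∈ D(N), X_r ⪯ Y_r (where the factor δ_{Y_r} may be absent, i.e., equal to 1), in which δ_{A∧B} δ_{A∨B} appears with coefficient 1; moreover wt(A) + wt(B) ≥ wt(X_r) + wt(Y_r) for all r, with equality only for (X_r, Y_r) = (A∧B, A∨B). -/

import Mathlib

noncomputable section

/-- One-line tableau predicate: `isTab n m I J` says `[I:J]` is a one-line tableau in `D(n,m)`,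
i.e. `I ⊆ {1,…,n}` and `J ⊆ {1,…,m}` are strictly increasing sequences of the same (positive) length. -/
def isTab (n m : ℕ) (I J : List ℕ) : Prop :=
  I.length = J.length ∧ I ≠ [] ∧ I.Chain' (· < ·) ∧ J.Chain' (· < ·) ∧
    (∀ x ∈ I, 1 ≤ x ∧ x ≤ n) ∧ ∀ x ∈ J, 1 ≤ x ∧ x ≤ m

/-- The tableau order `A ⪯ B` on one-line tableaux. -/
def tleq (A B : List ℕ × List ℕ) : Prop :=
  B.1.length ≤ A.1.length ∧
    ∀ r < B.1.length, A.1.getD r 0 ≤ B.1.getD r 0 ∧ A.2.getD r 0 ≤ B.2.getD r 0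

/-- The map ξ : `ξ([I:J]) = [j₁,…,jₕ, m+u₁,…,m+u_{n−h}]` where
`{n+1−u₁,…,n+1−u_{n−h}}` is the complement of `I` in `{1,…,n}`. -/
def xi (n m : ℕ) (I J : List ℕ) : List ℕ :=
  J ++ ((((List.range n).map (· + 1)).filter fun c => decide (c ∉ I)).reverse.map
      fun c => m + (n + 1 - c))

/-- The top element `[m+1, …, m+n]`. -/
def topL (n m : ℕ) : List ℕ := (List.range n).map fun r => m + r + 1

def xiInvI (n m : ℕ) (K : List ℕ) : List ℕ :=
  ((List.range n).map (· + 1)).filter fun i => decide (m + (n + 1 - i) ∉ K)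

def xiInvJ (m : ℕ) (K : List ℕ) : List ℕ := K.filter fun x => decide (x ≤ m)

/-- The meet `A ∧ B` in the distributive lattice `D(n,m)`, computed by transporting the
entrywise minimum through the order isomorphism ξ. -/
def tabMeet (n m : ℕ) (A B : List ℕ × List ℕ) : List ℕ × List ℕ :=
  (xiInvI n m (List.zipWith min (xi n m A.1 A.2) (xi n m B.1 B.2)),
    xiInvJ m (List.zipWith min (xi n m A.1 A.2) (xi n m B.1 B.2)))

/-- The join `A ∨ B` in the distributive lattice `D(n,m)`. -/
def tabJoin (n m : ℕ) (A B : List ℕ × List ℕ) : List ℕ × List ℕ :=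
  (xiInvI n m (List.zipWith max (xi n m A.1 A.2) (xi n m B.1 B.2)),
    xiInvJ m (List.zipWith max (xi n m A.1 A.2) (xi n m B.1 B.2)))

/-- `dmin n m I J` is the minor δ_{[I:J]} ∈ ℂ[M_{n,m}] : the determinant of the submatrix of
the generic n×m matrix of variables with rows `I` and columns `J` (1-based indices). -/
def dmin (n m : ℕ) (I J : List ℕ) : MvPolynomial (Fin n × Fin m) ℂ :=
  Matrix.det (Matrix.of fun a b : Fin I.length =>
    if h : I.getD a 0 - 1 < n ∧ J.getD b 0 - 1 < m then
      MvPolynomial.X (⟨I.getD a 0 - 1, h.1⟩, ⟨J.getD b 0 - 1, h.2⟩)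
    else 0)

/-- Weight of a length-`n` column list `K = [q₁,…,qₙ]` : `∑ (m+r−q_r)·N^{n−r}`. -/
def wtL (n m N : ℕ) (K : List ℕ) : ℕ :=
  ∑ r ∈ Finset.range n, (m + (r + 1) - K.getD r 0) * N ^ (n - 1 - r)

/-- Weight of a one-line tableau `[I:J]`, via ξ. -/
def wtTab (n m N : ℕ) (t : List ℕ × List ℕ) : ℕ := wtL n m N (xi n m t.1 t.2)

/-- The basic symplectic invariant `r_{ij} = ∑_u (x_{i,2u−1}x_{j,2u} − x_{j,2u−1}x_{i,2u})`
(with 0-based variable indices). -/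
def rbase (k n : ℕ) (i j : Fin k) : MvPolynomial (Fin k × Fin (2 * n)) ℂ :=
  ∑ u : Fin n,
    (MvPolynomial.X (i, ⟨2 * u.1, by have := u.isLt; omega⟩) *
        MvPolynomial.X (j, ⟨2 * u.1 + 1, by have := u.isLt; omega⟩) -
      MvPolynomial.X (j, ⟨2 * u.1, by have := u.isLt; omega⟩) *
        MvPolynomial.X (i, ⟨2 * u.1 + 1, by have := u.isLt; omega⟩))

/-- The ideal `I` of the nullcone, generated by the basic symplectic invariants. -/
def sympIdeal (k n : ℕ) : Ideal (MvPolynomial (Fin k × Fin (2 * n)) ℂ) :=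
  Ideal.span {f | ∃ i j : Fin k, i < j ∧ f = rbase k n i j}

/-- `Jtilde n J` means `J ⪰ J̃ = [1,3,…,2n−1]`, i.e. `ℓ(J) ≤ n` and the `r`-th entry of `J`
is at least `2r−1` (0-based: entry at index r is ≥ 2r+1). -/
def Jtilde (n : ℕ) (J : List ℕ) : Prop :=
  J.length ≤ n ∧ ∀ r < J.length, 2 * r + 1 ≤ J.getD r 0

/-- `D(𝒩)` : one-line tableaux `[I:J] ∈ D(k,2n)` with `ℓ([I:J]) ≤ min(k,n)` and `J ⪰ J̃`. -/
def isTabN (k n : ℕ) (I J : List ℕ) : Prop :=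
  isTab k (2 * n) I J ∧ I.length ≤ min k n ∧ Jtilde n J

/-- Rows of `b` on `S` and rows of `a` off `S`. -/
def mixRows {ι R : Type*} [DecidableEq ι] (S : Finset ι) (b a : Matrix ι ι R) : Matrix ι ι R :=
  Matrix.of fun i => if i ∈ S then b i else a i

section Exchange

variable {ι R : Type*} [DecidableEq ι] [Fintype ι] [CommRing R]

/-- The antisymmetrized exchange of the rows of `a` indexed by `S` with rows of `b`. -/
def exchangeSum (S : Finset ι) (a b : Matrix ι ι R) : R :=
  ∑ π : Equiv.Perm ι, Equiv.Perm.sign π •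
    ((mixRows S (b.submatrix π id) a).det * (mixRows S a (b.submatrix π id)).det)

theorem mixRows_mul (S : Finset ι) (b a G : Matrix ι ι R) :
    mixRows S b a * G = mixRows S (b * G) (a * G) := by
  ext i j
  simp only [mixRows, Matrix.mul_apply, Matrix.of_apply]
  split_ifs <;> rfl

theorem exchangeSum_mul (S : Finset ι) (a b G : Matrix ι ι R) :
    exchangeSum S (a * G) (b * G) = G.det ^ 2 * exchangeSum S a b := by
  unfold exchangeSum
  rw [Finset.mul_sum]
  refine Finset.sum_congr rfl fun π _ => ?_
  have h1 : mixRows S ((b * G).submatrix π id) (a * G) =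
      mixRows S (b.submatrix π id) a * G :=
    (mixRows_mul S (b.submatrix π id) a G).symm
  have h2 : mixRows S (a * G) ((b * G).submatrix π id) =
      mixRows S a (b.submatrix π id) * G :=
    (mixRows_mul S a (b.submatrix π id) G).symm
  rw [h1, h2, Matrix.det_mul, Matrix.det_mul, mul_smul_comm]
  congr 1
  ring

theorem mixRows_updateRow_mem {ι R : Type*} [DecidableEq ι] {S : Finset ι} {i : ι} (hi : i ∈ S)
    (b a : Matrix ι ι R) (x : ι → R) :
    mixRows S (b.updateRow i x) a = (mixRows S b a).updateRow i x := by
  ext r c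
  by_cases h : r = i
  · subst h; simp [mixRows, hi]
  · simp [mixRows, h]

theorem mixRows_updateRow_notMem {ι R : Type*} [DecidableEq ι] {S : Finset ι} {i : ι}
    (hi : i ∉ S) (b a : Matrix ι ι R) (x : ι → R) :
    mixRows S (b.updateRow i x) a = mixRows S b a := by
  ext r c
  by_cases h : r = i
  · subst h; simp [mixRows, hi]
  · simp [mixRows, h]

theorem mixRows_compl {ι R : Type*} [DecidableEq ι] [Fintype ι] (S : Finset ι)
    (b a : Matrix ι ι R) : mixRows Sᶜ b a = mixRows S a b := by
  ext r c
  by_cases h : r ∈ S <;> simp [mixRows, h]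

theorem of_update_eq_updateRow {ι R : Type*} [DecidableEq ι] (v : ι → ι → R) (i : ι)
    (x : ι → R) : Matrix.of (Function.update v i x) = (Matrix.of v).updateRow i x := by
  ext r c
  by_cases h : r = i
  · subst h; simp
  · simp [h]

/-- The exchange form, multilinear in the rows of the second matrix. -/
def exchangeMultilinear {ι R : Type*} [instD : DecidableEq ι] [Fintype ι] [CommRing R]
    (S : Finset ι) (a : Matrix ι ι R) : MultilinearMap R (fun _ : ι => ι → R) R where
  toFun v := (mixRows S (Matrix.of v) a).det * (mixRows Sᶜ (Matrix.of v) a).det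
  map_update_add' := by
    intro inst v i x y
    obtain rfl : inst = instD := Subsingleton.elim _ _
    by_cases hi : i ∈ S
    · have hi' : i ∉ Sᶜ := by simpa using hi
      simp only [of_update_eq_updateRow, mixRows_updateRow_mem hi, mixRows_updateRow_notMem hi',
        Matrix.det_updateRow_add]
      ring
    · have hi' : i ∈ Sᶜ := by simpa using hi
      simp only [of_update_eq_updateRow, mixRows_updateRow_notMem hi, mixRows_updateRow_mem hi',
        Matrix.det_updateRow_add]
      ring
  map_update_smul' := by
    intro inst v i x y
    obtain rfl : inst = instD := Subsingleton.elim _ _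
    by_cases hi : i ∈ S
    · have hi' : i ∉ Sᶜ := by simpa using hi
      simp only [of_update_eq_updateRow, mixRows_updateRow_mem hi, mixRows_updateRow_notMem hi',
        Matrix.det_updateRow_smul, smul_eq_mul]
      ring
    · have hi' : i ∈ Sᶜ := by simpa using hi
      simp only [of_update_eq_updateRow, mixRows_updateRow_notMem hi, mixRows_updateRow_mem hi',
        Matrix.det_updateRow_smul, smul_eq_mul]
      ring

theorem exchangeSum_eq_alternatization (S : Finset ι) (a : Matrix ι ι R) (b : ι → ι → R) :
    exchangeSum S a (Matrix.of b) =
      MultilinearMap.alternatization (exchangeMultilinear S a) b := by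
  rw [MultilinearMap.alternatization_apply]
  refine Finset.sum_congr rfl fun π _ => ?_
  have h : (Matrix.of b).submatrix π id = Matrix.of fun i => b (π i) := rfl
  simp [exchangeMultilinear, mixRows_compl, h]

theorem exchangeSum_det (S : Finset ι) (a b : Matrix ι ι R) :
    exchangeSum S a b = exchangeSum S a 1 * b.det := by
  have h1 : (⇑(Pi.basisFun R ι) : ι → ι → R) = Matrix.of.symm (1 : Matrix ι ι R) := by
    ext i j
    simp [Matrix.one_apply, Pi.single_apply, eq_comm]
  have h2 : ∀ b : Matrix ι ι R, (Pi.basisFun R ι).det (Matrix.of.symm b) = b.det := by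
    intro b
    rw [Pi.basisFun_det]; rfl
  have key := exchangeSum_eq_alternatization S a (Matrix.of.symm b)
  have key' := exchangeSum_eq_alternatization S a (Matrix.of.symm (1 : Matrix ι ι R))
  rw [Equiv.apply_symm_apply] at key key'
  rw [key, key', AlternatingMap.eq_smul_basis_det (Pi.basisFun R ι)
      (MultilinearMap.alternatization (exchangeMultilinear S a))]
  simp only [AlternatingMap.smul_apply, h1, h2, smul_eq_mul, mul_one, Matrix.det_one]

theorem exchangeSum_of_det_ne_zero [IsDomain R] (S : Finset ι) (a b : Matrix ι ι R)
    (ha : a.det ≠ 0) :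
    exchangeSum S a b =
      exchangeSum S (1 : Matrix ι ι R) (1 : Matrix ι ι R) * (a.det * b.det) := by
  have hd : (a.adjugate).det ≠ 0 := by
    rw [Matrix.det_adjugate]
    exact pow_ne_zero _ ha
  have key : ∀ c : R, exchangeSum S (c • (1 : Matrix ι ι R)) (1 : Matrix ι ι R) =
      c ^ Fintype.card ι * exchangeSum S (1 : Matrix ι ι R) (1 : Matrix ι ι R) := by
    intro c
    unfold exchangeSum
    rw [Finset.mul_sum]
    refine Finset.sum_congr rfl fun π _ => ?_
    have h1 : mixRows S ((1 : Matrix ι ι R).submatrix π id) (c • (1 : Matrix ι ι R)) =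
        Matrix.diagonal (fun i => if i ∈ S then 1 else c) *
          mixRows S ((1 : Matrix ι ι R).submatrix π id) (1 : Matrix ι ι R) := by
      ext i j
      by_cases h : i ∈ S <;> simp [mixRows, h]
    have h2 : mixRows S (c • (1 : Matrix ι ι R)) ((1 : Matrix ι ι R).submatrix π id) =
        Matrix.diagonal (fun i => if i ∈ S then c else 1) *
          mixRows S (1 : Matrix ι ι R) ((1 : Matrix ι ι R).submatrix π id) := by
      ext i j
      by_cases h : i ∈ S <;> simp [mixRows, h]
    have h3 : (∏ i : ι, if i ∈ S then (1 : R) else c) * (∏ i : ι, if i ∈ S then c else 1) =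
        c ^ Fintype.card ι := by
      rw [← Finset.prod_mul_distrib]
      have : ∀ i : ι, ((if i ∈ S then (1 : R) else c) * if i ∈ S then c else 1) = c := by
        intro i; split_ifs <;> simp
      simp [this]
    rw [h1, h2, Matrix.det_mul, Matrix.det_mul, Matrix.det_diagonal, Matrix.det_diagonal, ← h3,
      mul_smul_comm]
    congr 1
    ring
  apply mul_left_cancel₀ (pow_ne_zero 2 hd)
  rw [← exchangeSum_mul, Matrix.mul_adjugate, exchangeSum_det, key, Matrix.det_mul]
  have h4 : a.det ^ Fintype.card ι = a.det * a.adjugate.det := by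
    rw [← Matrix.det_mul, Matrix.mul_adjugate]
    simp
  rw [h4]
  ring

theorem map_exchangeSum {R' : Type*} [CommRing R'] (f : R →+* R') (S : Finset ι)
    (a b : Matrix ι ι R) :
    f (exchangeSum S a b) = exchangeSum S (f.mapMatrix a) (f.mapMatrix b) := by
  unfold exchangeSum
  rw [map_sum]
  refine Finset.sum_congr rfl fun π _ => ?_
  have h1 : ∀ u v : Matrix ι ι R, f.mapMatrix (mixRows S u v) =
      mixRows S (f.mapMatrix u) (f.mapMatrix v) := by
    intro u v
    ext i j
    by_cases h : i ∈ S <;> simp [mixRows, h]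
  have h2 : f.mapMatrix (b.submatrix π id) = (f.mapMatrix b).submatrix π id := rfl
  simp only [Units.smul_def, zsmul_eq_mul, map_mul, map_intCast, RingHom.map_det, h1, h2]

theorem exchangeSum_eq [IsDomain R] (S : Finset ι) (a b : Matrix ι ι R) :
    exchangeSum S a b =
      exchangeSum S (1 : Matrix ι ι R) (1 : Matrix ι ι R) * (a.det * b.det) := by
  have h := exchangeSum_of_det_ne_zero S (-a).charmatrix (Polynomial.C.mapMatrix b)
    (Matrix.charpoly_monic (-a)).ne_zero
  have h' := congrArg (Polynomial.evalRingHom (0 : R)) h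
  have e1 : (Polynomial.evalRingHom (0 : R)).mapMatrix (-a).charmatrix = a := by
    ext i j
    by_cases hij : i = j <;> simp [hij]
  have e2 : (Polynomial.evalRingHom (0 : R)).mapMatrix (Polynomial.C.mapMatrix b) = b := by
    ext i j
    simp
  simpa only [map_exchangeSum, map_mul, RingHom.map_det, e1, e2, map_one] using h'

/-- Permutations preserving `S` contribute equal terms to the exchange sum. -/
theorem exchange_term_of_stable (S : Finset ι) (a b : Matrix ι ι R) (π : Equiv.Perm ι)
    (hπ : ∀ i, π i ∈ S ↔ i ∈ S) :
    Equiv.Perm.sign π •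
      ((mixRows S (b.submatrix π id) a).det * (mixRows S a (b.submatrix π id)).det) =
      (mixRows S b a).det * (mixRows S a b).det := by
  set σ : Equiv.Perm ι := Equiv.Perm.ofSubtype (p := fun i => i ∈ S) (π.subtypePerm hπ) with hσ
  set τ : Equiv.Perm ι := σ⁻¹ * π with hτ
  have hσ1 : ∀ i ∈ S, σ i = π i := fun i hi => by
    rw [hσ, Equiv.Perm.ofSubtype_apply_of_mem _ hi]; rfl
  have hσ2 : ∀ i ∉ S, σ i = i := fun i hi => by
    rw [hσ, Equiv.Perm.ofSubtype_apply_of_not_mem _ hi]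
  have hτ1 : ∀ i ∈ S, τ i = i := fun i hi => by
    rw [hτ, Equiv.Perm.mul_apply, ← hσ1 i hi, Equiv.Perm.inv_eq_iff_eq]
  have hτ2 : ∀ i ∉ S, τ i = π i := fun i hi => by
    rw [hτ, Equiv.Perm.mul_apply, Equiv.Perm.inv_eq_iff_eq, hσ2 _ (fun h => hi ((hπ i).1 h))]
  have hmul : σ * τ = π := by simp [hτ]
  have hσS : ∀ i ∈ S, σ i ∈ S := fun i hi => by rw [hσ1 i hi]; exact (hπ i).2 hi
  have hτS : ∀ i ∉ S, τ i ∉ S := fun i hi => by rw [hτ2 i hi]; exact fun h => hi ((hπ i).1 h)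
  have h1 : mixRows S (b.submatrix π id) a = (mixRows S b a).submatrix σ id := by
    ext i j
    by_cases h : i ∈ S
    · simp [mixRows, h, hσ1 i h, (hπ i).2 h]
    · simp [mixRows, h, hσ2 i h]
  have h2 : mixRows S a (b.submatrix π id) = (mixRows S a b).submatrix τ id := by
    ext i j
    by_cases h : i ∈ S
    · simp [mixRows, h, hτ1 i h]
    · have := hτS i h
      rw [hτ2 i h] at this
      simp [mixRows, h, this, hτ2 i h]
  rw [h1, h2, Matrix.det_permute, Matrix.det_permute, ← hmul, Equiv.Perm.sign_mul]
  rcases Int.units_eq_one_or (Equiv.Perm.sign σ) with h | h <;>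
    rcases Int.units_eq_one_or (Equiv.Perm.sign τ) with h' | h' <;> simp [h, h']

/-- The exchange relation with the coefficient of the leading term split off. -/
theorem exchange_relation [IsDomain R] (S : Finset ι) (a b : Matrix ι ι R) :
    ∃ N : ℕ, 0 < N ∧ (N : R) * (a.det * b.det) =
      N * ((mixRows S b a).det * (mixRows S a b).det) +
      ∑ π : Equiv.Perm ι with ¬ ∀ i, π i ∈ S ↔ i ∈ S, Equiv.Perm.sign π •
        ((mixRows S (b.submatrix π id) a).det * (mixRows S a (b.submatrix π id)).det) := by
  have hsum : ∀ a b : Matrix ι ι R, exchangeSum S a b =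
      ((Finset.univ.filter fun π : Equiv.Perm ι => ∀ i, π i ∈ S ↔ i ∈ S).card : R) *
        ((mixRows S b a).det * (mixRows S a b).det) +
      ∑ π : Equiv.Perm ι with ¬ ∀ i, π i ∈ S ↔ i ∈ S, Equiv.Perm.sign π •
        ((mixRows S (b.submatrix π id) a).det * (mixRows S a (b.submatrix π id)).det) := by
    intro a b
    unfold exchangeSum
    rw [← Finset.sum_filter_add_sum_filter_not Finset.univ
      (fun π : Equiv.Perm ι => ∀ i, π i ∈ S ↔ i ∈ S)]
    congr 1
    rw [Finset.sum_congr rfl fun π hπ =>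
      exchange_term_of_stable S a b π (Finset.mem_filter.1 hπ).2]
    simp
  have hone : exchangeSum S (1 : Matrix ι ι R) (1 : Matrix ι ι R) =
      ((Finset.univ.filter fun π : Equiv.Perm ι => ∀ i, π i ∈ S ↔ i ∈ S).card : R) := by
    have h1 : mixRows S (1 : Matrix ι ι R) (1 : Matrix ι ι R) = 1 := by
      ext i j; simp [mixRows]
    rw [hsum, h1, Finset.sum_eq_zero, Matrix.det_one, mul_one, mul_one, add_zero]
    intro π hπ
    obtain ⟨i, hi, hi'⟩ : ∃ i ∈ S, π i ∉ S := by
      by_contra! hcon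
      refine (Finset.mem_filter.1 hπ).2 fun i => ⟨fun h => ?_, hcon i⟩
      have hS : S.map π.toEmbedding = S := by
        refine Finset.eq_of_subset_of_card_le ?_ (by simp)
        intro x hx
        obtain ⟨y, hy, rfl⟩ := Finset.mem_map.1 hx
        exact hcon y hy
      rw [← hS] at h
      simpa using h
    have hne : i ≠ π i := fun h => hi' (h ▸ hi)
    have hrow : mixRows S ((1 : Matrix ι ι R).submatrix π id) 1 i =
        mixRows S ((1 : Matrix ι ι R).submatrix π id) 1 (π i) := by
      ext c
      simp only [mixRows, Matrix.of_apply, hi, hi', if_true, if_false]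
      rfl
    rw [Matrix.det_zero_of_row_eq hne hrow, zero_mul, smul_zero]
  refine ⟨(Finset.univ.filter fun π : Equiv.Perm ι => ∀ i, π i ∈ S ↔ i ∈ S).card,
    Finset.card_pos.2 ⟨1, Finset.mem_filter.2 ⟨Finset.mem_univ _, fun i => Iff.rfl⟩⟩, ?_⟩
  rw [← hone, ← exchangeSum_eq, hsum, hone]

end Exchange
/-- The maximal minor with columns `q` of a matrix given by its columns. -/
def maxMinor {k : ℕ} {R : Type*} [CommRing R] (c : ℕ → Fin k → R) (q : Fin k → ℕ) : R :=
  (Matrix.of fun r => c (q r)).det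

theorem maxMinor_eq_zero {k : ℕ} {R : Type*} [CommRing R] (c : ℕ → Fin k → R) {q : Fin k → ℕ}
    (hq : ¬ Function.Injective q) : maxMinor c q = 0 := by
  simp only [Function.Injective, not_forall] at hq
  obtain ⟨i, j, hij, hne⟩ := hq
  refine Matrix.det_zero_of_row_eq hne ?_
  ext s
  simp [hij]

theorem maxMinor_comp_perm {k : ℕ} {R : Type*} [CommRing R] (c : ℕ → Fin k → R) (q : Fin k → ℕ)
    (σ : Equiv.Perm (Fin k)) :
    maxMinor c (q ∘ σ) = maxMinor c q ∨ maxMinor c (q ∘ σ) = -maxMinor c q := by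
  have h : maxMinor c (q ∘ σ) = (Equiv.Perm.sign σ : ℤ) * maxMinor c q :=
    Matrix.det_permute σ (Matrix.of fun r => c (q r))
  rcases Int.units_eq_one_or (Equiv.Perm.sign σ) with hs | hs <;> simp [h, hs]

theorem exists_sorted_maxMinor {k : ℕ} {q : Fin k → ℕ} (hq : Function.Injective q) :
    ∃ x : Fin k → ℕ, StrictMono x ∧ Set.range x = Set.range q ∧
      ∀ {R : Type} [CommRing R] (c : ℕ → Fin k → R),
        maxMinor c q = maxMinor c x ∨ maxMinor c q = -maxMinor c x := by
  refine ⟨q ∘ Tuple.sort q, (Tuple.monotone_sort q).strictMono_of_injective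
    (hq.comp (Equiv.injective _)), EquivLike.range_comp q _, fun c => ?_⟩
  rcases maxMinor_comp_perm c q (Tuple.sort q) with h | h
  · exact Or.inl h.symm
  · exact Or.inr (by rw [h, neg_neg])

theorem map_maxMinor {k : ℕ} {R R' : Type*} [CommRing R] [CommRing R'] (f : R →+* R')
    (c : ℕ → Fin k → R) (q : Fin k → ℕ) :
    f (maxMinor c q) = maxMinor (fun a i => f (c a i)) q := by
  rw [maxMinor, RingHom.map_det]
  rfl

/-- Strictly increasing column indices between `1` and `m + k`. -/
structure IsColumn (k m : ℕ) (q : Fin k → ℕ) : Prop where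
  strictMono : StrictMono q
  one_le (i : Fin k) : 1 ≤ q i
  le (i : Fin k) : q i ≤ m + k

/-- The weight of a column. -/
def colWeight (k m M : ℕ) (q : Fin k → ℕ) : ℕ :=
  ∑ r : Fin k, (m + (r + 1) - q r) * M ^ (k - 1 - r)

theorem IsColumn.le_add {k m : ℕ} {q : Fin k → ℕ} (hq : IsColumn k m q) (i : Fin k) :
    q i ≤ m + (i + 1) := by
  obtain ⟨i, hi⟩ := i
  have key : ∀ d j : ℕ, ∀ hj : j < k, j + d + 1 = k → q ⟨j, hj⟩ + d ≤ m + k := by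
    intro d
    induction d with
    | zero => intro j hj _; exact hq.le _
    | succ d ih =>
      intro j hj h
      have h1 := ih (j + 1) (by omega) (by omega)
      have h2 : q ⟨j, hj⟩ < q ⟨j + 1, by omega⟩ := hq.strictMono (by simp [Fin.lt_def])
      omega
  have := key (k - 1 - i) i hi (by omega)
  simp only
  omega

theorem IsColumn.add_one_le {k m : ℕ} {q : Fin k → ℕ} (hq : IsColumn k m q) (i : Fin k) :
    (i : ℕ) + 1 ≤ q i := by
  obtain ⟨i, hi⟩ := i
  induction i with
  | zero => exact hq.one_le _
  | succ i ih =>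
    have h1 := ih (by omega)
    have h2 : q ⟨i, by omega⟩ < q ⟨i + 1, hi⟩ := hq.strictMono (by simp [Fin.lt_def])
    simp only at h1 ⊢
    omega

theorem digits_lt {k M : ℕ} (d e : ℕ → ℕ) {t : ℕ} (ht : t < k) (hd : ∀ i < k, d i < M)
    (heq : ∀ i < t, d i = e i) (hlt : d t < e t) :
    ∑ r ∈ Finset.range k, d r * M ^ (k - 1 - r) < ∑ r ∈ Finset.range k, e r * M ^ (k - 1 - r) := by
  have hstep : ∀ (f : ℕ → ℕ) (k : ℕ), ∑ r ∈ Finset.range (k + 1), f r * M ^ (k + 1 - 1 - r) =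
      M * ∑ r ∈ Finset.range k, f r * M ^ (k - 1 - r) + f k := by
    intro f k
    rw [Finset.sum_range_succ, Finset.mul_sum]
    congr 1
    · refine Finset.sum_congr rfl fun r hr => ?_
      have hr' := Finset.mem_range.1 hr
      have : k + 1 - 1 - r = (k - 1 - r) + 1 := by omega
      rw [this, pow_succ]
      ring
    · simp
  induction k with
  | zero => omega
  | succ k ih =>
    rw [hstep, hstep]
    rcases Nat.lt_succ_iff_lt_or_eq.1 ht with h | h
    · have h1 := ih h fun i hi => hd i (by omega)
      have h2 := hd k (by omega)
      have h3 : M * (∑ r ∈ Finset.range k, d r * M ^ (k - 1 - r) + 1) ≤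
        M * ∑ r ∈ Finset.range k, e r * M ^ (k - 1 - r) := Nat.mul_le_mul_left _ h1
      rw [mul_add] at h3
      omega
    · subst h
      have h1 : ∑ r ∈ Finset.range t, d r * M ^ (t - 1 - r) =
          ∑ r ∈ Finset.range t, e r * M ^ (t - 1 - r) :=
        Finset.sum_congr rfl fun r hr => by rw [heq r (Finset.mem_range.1 hr)]
      rw [h1]
      omega

theorem fin_digits_lt {k M : ℕ} (d e : Fin k → ℕ) (t : Fin k) (hd : ∀ i, d i < M)
    (heq : ∀ i < t, d i = e i) (hlt : d t < e t) :
    ∑ r : Fin k, d r * M ^ (k - 1 - r) < ∑ r : Fin k, e r * M ^ (k - 1 - r) := by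
  have h := digits_lt (k := k) (M := M) (fun i => if h : i < k then d ⟨i, h⟩ else 0)
    (fun i => if h : i < k then e ⟨i, h⟩ else 0) t.isLt
    (fun i hi => by simp [hi, hd]) (fun i hi => by
      have hik : i < k := hi.trans t.isLt
      simp [hik, heq ⟨i, hik⟩ hi]) (by simpa using hlt)
  simpa [Finset.sum_range] using h

theorem colWeight_lt {k m M : ℕ} (hM : 2 * m < M) {x q : Fin k → ℕ} (hx : IsColumn k m x)
    (t : Fin k) (heq : ∀ i < t, x i = q i) (hlt : q t < x t) :
    colWeight k m M x < colWeight k m M q := by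
  refine fin_digits_lt _ _ t (fun i => ?_) (fun i hi => by rw [heq i hi]) ?_
  · have := hx.add_one_le i
    omega
  · have := hx.le_add t
    omega

theorem colWeight_add_lt {k m M : ℕ} (hM : 2 * m < M) {x y a b : Fin k → ℕ}
    (hx : IsColumn k m x) (hy : IsColumn k m y) (t : Fin k)
    (hxa : ∀ i ≤ t, x i = a i) (hyb : ∀ i < t, y i = b i) (hlt : b t < y t) :
    colWeight k m M x + colWeight k m M y < colWeight k m M a + colWeight k m M b := by
  have hsum : ∀ u v : Fin k → ℕ, colWeight k m M u + colWeight k m M v =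
      ∑ r : Fin k, ((m + (r + 1) - u r) + (m + (r + 1) - v r)) * M ^ (k - 1 - r) := by
    intro u v
    simp only [colWeight, add_mul, Finset.sum_add_distrib]
  rw [hsum, hsum]
  refine fin_digits_lt _ _ t (fun i => ?_) (fun i hi => by rw [hxa i hi.le, hyb i hi]) ?_
  · have := hx.add_one_le i
    have := hy.add_one_le i
    omega
  · have := hy.le_add t
    rw [hxa t le_rfl]
    omega

theorem colWeight_add_congr {k m M : ℕ} {x y a b : Fin k → ℕ}
    (h : ∀ i, x i = a i ∧ y i = b i ∨ x i = b i ∧ y i = a i) :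
    colWeight k m M x + colWeight k m M y = colWeight k m M a + colWeight k m M b := by
  simp only [colWeight, ← Finset.sum_add_distrib]
  refine Finset.sum_congr rfl fun i _ => ?_
  rcases h i with ⟨h1, h2⟩ | ⟨h1, h2⟩ <;> rw [h1, h2]
  exact add_comm _ _

theorem eq_of_range_agree {k : ℕ} {x q : Fin k → ℕ} (hx : StrictMono x)
    (hq : StrictMono q) {a : ℕ} (h : ∀ v < a, v ∈ Set.range q ↔ v ∈ Set.range x) (i : Fin k)
    (hi : q i < a) : x i = q i := by
  induction i using WellFoundedLT.induction with
  | ind i ih =>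
    have hlt : ∀ j < i, x j = q j := fun j hj => ih j hj ((hq hj).trans hi)
    obtain ⟨j, hj⟩ := (h _ hi).1 ⟨i, rfl⟩
    have hij : i ≤ j := by
      by_contra hcon
      have h1 := hlt j (not_le.1 hcon)
      have h2 := hq (not_le.1 hcon)
      omega
    have hle : x i ≤ q i := hj ▸ hx.monotone hij
    by_contra hne
    have hxi : x i < q i := lt_of_le_of_ne hle hne
    obtain ⟨l, hl⟩ := (h _ (hxi.trans hi)).2 ⟨i, rfl⟩
    have hli : l < i := hq.lt_iff_lt.1 (by omega)
    have h1 := hlt l hli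
    have h2 := hx hli
    omega

theorem lt_of_range_agree {k : ℕ} {x q : Fin k → ℕ} (hx : StrictMono x)
    (hq : StrictMono q) (t : Fin k) (h : ∀ v < q t, v ∈ Set.range q ↔ v ∈ Set.range x)
    (ht : q t ∉ Set.range x) : (∀ i < t, x i = q i) ∧ q t < x t := by
  refine ⟨fun i hi => eq_of_range_agree hx hq h i (hq hi), ?_⟩
  by_contra hcon
  rcases (not_lt.1 hcon).lt_or_eq with hlt | heq
  · have := eq_of_range_agree hq hx (fun v hv => (h v hv).symm) t hlt
    omega
  · exact ht ⟨t, heq⟩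

/-- Products of two maximal minors of smaller weight. -/
def lowerProducts {k : ℕ} {R : Type*} [CommRing R] (m M : ℕ) (c : ℕ → Fin k → R)
    (w : ℕ) : Set R :=
  {z | ∃ x y : Fin k → ℕ, IsColumn k m x ∧ IsColumn k m y ∧ ((∃ i, x i ≤ m) ∨ ∃ i, y i ≤ m) ∧
    colWeight k m M x + colWeight k m M y < w ∧ z = maxMinor c x * maxMinor c y}

theorem exchange_term_mem {k m M : ℕ} (hM : 2 * m < M) {R : Type} [CommRing R] [Algebra ℂ R]
    (c : ℕ → Fin k → R) {a b : Fin k → ℕ} (ha : IsColumn k m a) (hb : IsColumn k m b)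
    (hab : (∃ i, a i ≤ m) ∨ ∃ i, b i ≤ m) (r : Fin k) (hle : ∀ i < r, a i ≤ b i)
    (hr : b r < a r) (π : Equiv.Perm (Fin k)) (hπ : ¬ ∀ i, r ≤ π i ↔ r ≤ i) :
    maxMinor c (fun i => if r ≤ i then b (π i) else a i) *
      maxMinor c (fun i => if r ≤ i then a i else b (π i)) ∈
      Submodule.span ℂ (lowerProducts m M c (colWeight k m M a + colWeight k m M b)) := by
  set y₁ : Fin k → ℕ := fun i => if r ≤ i then b (π i) else a i with hy₁
  set y₂ : Fin k → ℕ := fun i => if r ≤ i then a i else b (π i) with hy₂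
  by_cases h₁ : Function.Injective y₁
  swap
  · rw [maxMinor_eq_zero c h₁, zero_mul]; exact zero_mem _
  by_cases h₂ : Function.Injective y₂
  swap
  · rw [maxMinor_eq_zero c h₂, mul_zero]; exact zero_mem _
  obtain ⟨x, hx, hxr, hxm⟩ := exists_sorted_maxMinor h₁
  obtain ⟨y, hy, hyr, hym⟩ := exists_sorted_maxMinor h₂
  have hxc : IsColumn k m x := by
    have : ∀ i, ∃ j, y₁ j = x i := fun i => by rw [← Set.mem_range, ← hxr]; exact ⟨i, rfl⟩
    refine ⟨hx, fun i => ?_, fun i => ?_⟩ <;> obtain ⟨j, hj⟩ := this i <;> rw [← hj, hy₁] <;>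
      dsimp only <;> split_ifs
    exacts [hb.one_le _, ha.one_le _, hb.le _, ha.le _]
  have hyc : IsColumn k m y := by
    have : ∀ i, ∃ j, y₂ j = y i := fun i => by rw [← Set.mem_range, ← hyr]; exact ⟨i, rfl⟩
    refine ⟨hy, fun i => ?_, fun i => ?_⟩ <;> obtain ⟨j, hj⟩ := this i <;> rw [← hj, hy₂] <;>
      dsimp only <;> split_ifs
    exacts [ha.one_le _, hb.one_le _, ha.le _, hb.le _]
  have hsmall : (∃ i, x i ≤ m) ∨ ∃ i, y i ≤ m := by
    have key : (∃ i, y₁ i ≤ m) ∨ ∃ i, y₂ i ≤ m := by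
      rcases hab with ⟨i, hi⟩ | ⟨i, hi⟩
      · by_cases h : r ≤ i
        · exact Or.inr ⟨i, by simpa [hy₂, h] using hi⟩
        · exact Or.inl ⟨i, by simpa [hy₁, h] using hi⟩
      · by_cases h : r ≤ π.symm i
        · exact Or.inl ⟨π.symm i, by simpa [hy₁, h] using hi⟩
        · exact Or.inr ⟨π.symm i, by simpa [hy₂, h] using hi⟩
    refine key.imp ?_ ?_
    · rintro ⟨i, hi⟩
      obtain ⟨j, hj⟩ : y₁ i ∈ Set.range x := hxr ▸ ⟨i, rfl⟩
      exact ⟨j, hj ▸ hi⟩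
    · rintro ⟨i, hi⟩
      obtain ⟨j, hj⟩ : y₂ i ∈ Set.range y := hyr ▸ ⟨i, rfl⟩
      exact ⟨j, hj ▸ hi⟩
  -- the least index moved from `b` into the first factor
  have hT : ∃ t : Fin k, r ≤ π.symm t ∧ t < r := by
    by_contra! hcon
    refine hπ fun i => ⟨fun h => ?_, fun h => hcon (π i) (by simpa using h)⟩
    have hS : (Finset.Ici r).map π.toEmbedding = Finset.Ici r := by
      refine Finset.eq_of_subset_of_card_le ?_ (by simp)
      intro x hx
      obtain ⟨y, hy, rfl⟩ := Finset.mem_map.1 hx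
      exact Finset.mem_Ici.2 (hcon (π y) (by simpa using hy))
    have h' : π i ∈ (Finset.Ici r).map π.toEmbedding := by rw [hS]; simpa using h
    simpa using h'
  obtain ⟨t, ⟨htS, htr⟩, htmin⟩ : ∃ t : Fin k, (r ≤ π.symm t ∧ t < r) ∧
      ∀ u, (r ≤ π.symm u ∧ u < r) → t ≤ u := by
    obtain ⟨t, ht⟩ := (Set.toFinite {t : Fin k | r ≤ π.symm t ∧ t < r}).exists_minimal hT
    exact ⟨t, ht.1, fun u hu => (le_total t u).elim id fun h => ht.2 hu h⟩
  have hmin : ∀ u, r ≤ π.symm u → t ≤ u := fun u hu => by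
    by_cases h : u < r
    · exact htmin u ⟨hu, h⟩
    · exact htr.le.trans (not_lt.1 h)
  have hatbt : a t < b t := by
    refine lt_of_le_of_ne (hle t htr) fun heq => ?_
    have : y₁ t = y₁ (π.symm t) := by simp [hy₁, htS, not_le.2 htr, heq]
    rw [h₁ this] at htr
    exact absurd htr (not_lt.2 htS)
  have hyt : (∀ i < t, y i = b i) ∧ b t < y t := by
    refine lt_of_range_agree hy hb.strictMono t (fun v hv => ?_) ?_
    · rw [hyr]
      constructor
      · rintro ⟨i, rfl⟩
        have hi : i < t := hb.strictMono.lt_iff_lt.1 hv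
        refine ⟨π.symm i, ?_⟩
        have : ¬ r ≤ π.symm i := fun h => absurd (hmin i h) (not_le.2 hi)
        simp [hy₂, this]
      · rintro ⟨i, rfl⟩
        by_cases h : r ≤ i
        · have h1 : a r ≤ a i := ha.strictMono.monotone h
          have h2 := hb.strictMono htr
          simp only [hy₂, h, if_true] at hv
          omega
        · simp [hy₂, h]
    · rw [hyr]
      rintro ⟨i, hi⟩
      by_cases h : r ≤ i
      · have h1 : a r ≤ a i := ha.strictMono.monotone h
        have h2 := hb.strictMono htr
        simp only [hy₂, h, if_true] at hi
        omega
      · simp only [hy₂, h, if_false] at hi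
        have := hb.strictMono.injective hi
        rw [← this] at htS
        simp [h] at htS
  have hxt : ∀ i ≤ t, x i = a i := by
    have := eq_of_range_agree (a := a t + 1) hx ha.strictMono (fun v hv => ?_)
    · exact fun i hi => this i (Nat.lt_succ_of_le (ha.strictMono.monotone hi))
    · rw [hxr]
      constructor
      · rintro ⟨i, rfl⟩
        have hi : i ≤ t := ha.strictMono.le_iff_le.1 (Nat.lt_succ_iff.1 hv)
        exact ⟨i, by simp [hy₁, not_le.2 (hi.trans_lt htr)]⟩
      · rintro ⟨i, rfl⟩
        by_cases h : r ≤ i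
        · have h1 : b t ≤ b (π i) := hb.strictMono.monotone (hmin _ (by simpa using h))
          simp only [hy₁, h, if_true] at hv
          omega
        · simp [hy₁, h]
  have hmem : maxMinor c x * maxMinor c y ∈ Submodule.span ℂ
      (lowerProducts m M c (colWeight k m M a + colWeight k m M b)) :=
    Submodule.subset_span ⟨x, y, hxc, hyc, hsmall,
      colWeight_add_lt hM hxc hyc t hxt hyt.1 hyt.2, rfl⟩
  rcases hxm c with h | h <;> rcases hym c with h' | h' <;> rw [h, h'] <;>
    simpa using hmem

/-- Exchanging the tails of two columns at the first descent, up to lower weight. -/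
theorem swap_tails {k m M : ℕ} (hM : 2 * m < M) {R : Type} [CommRing R] [IsDomain R]
    [Algebra ℂ R] (c : ℕ → Fin k → R) {a b : Fin k → ℕ} (ha : IsColumn k m a)
    (hb : IsColumn k m b) (hab : (∃ i, a i ≤ m) ∨ ∃ i, b i ≤ m) (r : Fin k)
    (hle : ∀ i < r, a i ≤ b i) (hr : b r < a r) :
    maxMinor c a * maxMinor c b - maxMinor c (fun i => if r ≤ i then b i else a i) *
      maxMinor c (fun i => if r ≤ i then a i else b i) ∈
      Submodule.span ℂ (lowerProducts m M c (colWeight k m M a + colWeight k m M b)) := by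
  obtain ⟨N, hN, h⟩ := exchange_relation (Finset.Ici r)
    (Matrix.of fun i => c (a i)) (Matrix.of fun i => c (b i))
  have hmix : ∀ (u v : Fin k → ℕ), (mixRows (Finset.Ici r) (Matrix.of fun i => c (u i))
      (Matrix.of fun i => c (v i))).det = maxMinor c fun i => if r ≤ i then u i else v i := by
    intro u v
    unfold maxMinor
    congr 1
    ext i j
    by_cases h : r ≤ i <;> simp [mixRows, h]
  have hsub : ∀ π : Equiv.Perm (Fin k), (Matrix.of fun i => c (b i)).submatrix π id =
      Matrix.of fun i => c ((b ∘ π) i) := fun π => rfl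
  simp only [hsub, hmix, Finset.mem_Ici] at h
  have hN' : (N : ℂ) ≠ 0 := Nat.cast_ne_zero.2 hN.ne'
  rw [← Submodule.smul_mem_iff _ hN']
  have h' : (N : ℂ) • (maxMinor c a * maxMinor c b -
      maxMinor c (fun i => if r ≤ i then b i else a i) *
        maxMinor c (fun i => if r ≤ i then a i else b i)) =
      (N : R) * (maxMinor c a * maxMinor c b) -
        N * (maxMinor c (fun i => if r ≤ i then b i else a i) *
          maxMinor c (fun i => if r ≤ i then a i else b i)) := by
    rw [Algebra.smul_def, map_natCast, mul_sub]
  have hdet : ∀ u : Fin k → ℕ, (Matrix.of fun i => c (u i)).det = maxMinor c u := fun _ => rfl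
  rw [hdet, hdet] at h
  rw [h', h, add_sub_cancel_left]
  refine Submodule.sum_mem _ fun π hπ => ?_
  have hmem := exchange_term_mem hM c ha hb hab r hle hr π (Finset.mem_filter.1 hπ).2
  rcases Int.units_eq_one_or (Equiv.Perm.sign π) with hs | hs <;>
    simpa [hs, Units.smul_def] using hmem

/-- Straightening of a product of two maximal minors, up to lower weight. -/
theorem straighten {k m M : ℕ} (hM : 2 * m < M) {R : Type} [CommRing R] [IsDomain R]
    [Algebra ℂ R] (c : ℕ → Fin k → R) {a b : Fin k → ℕ} (ha : IsColumn k m a)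
    (hb : IsColumn k m b) (hab : (∃ i, a i ≤ m) ∨ ∃ i, b i ≤ m) :
    maxMinor c a * maxMinor c b - maxMinor c (a ⊓ b) * maxMinor c (a ⊔ b) ∈
      Submodule.span ℂ (lowerProducts m M c (colWeight k m M a + colWeight k m M b)) := by
  have key : ∀ d r : ℕ, r + d = k → ∀ {a b : Fin k → ℕ}, IsColumn k m a → IsColumn k m b →
      ((∃ i, a i ≤ m) ∨ ∃ i, b i ≤ m) → (∀ i : Fin k, (i : ℕ) < r → a i ≤ b i) →
      maxMinor c a * maxMinor c b - maxMinor c (a ⊓ b) * maxMinor c (a ⊔ b) ∈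
        Submodule.span ℂ (lowerProducts m M c (colWeight k m M a + colWeight k m M b)) := by
    intro d
    induction d with
    | zero =>
      intro r hr a b _ _ _ h
      have hle : a ≤ b := fun i => h i (by omega)
      rw [inf_eq_left.2 hle, sup_eq_right.2 hle, sub_self]
      exact zero_mem _
    | succ d ih =>
      intro r hr a b ha hb hab h
      by_cases hc : a ⟨r, by omega⟩ ≤ b ⟨r, by omega⟩
      · refine ih (r + 1) (by omega) ha hb hab fun i hi => ?_
        rcases Nat.lt_succ_iff_lt_or_eq.1 hi with h1 | h1
        · exact h i h1
        · have : i = ⟨r, by omega⟩ := Fin.ext h1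
          rw [this]; exact hc
      · set s : Fin k := ⟨r, by omega⟩ with hs
        have hlt : b s < a s := not_le.1 hc
        have hswap := swap_tails hM c ha hb hab s (fun i hi => h i hi) hlt
        set a' : Fin k → ℕ := fun i => if s ≤ i then b i else a i with ha'
        set b' : Fin k → ℕ := fun i => if s ≤ i then a i else b i with hb'
        have hcases : ∀ i, a' i = a i ∧ b' i = b i ∨ a' i = b i ∧ b' i = a i := fun i => by
          by_cases hi : s ≤ i <;> simp [ha', hb', hi]
        have hac : IsColumn k m a' := by
          refine ⟨fun i j hij => ?_, fun i => ?_, fun i => ?_⟩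
          · have h1 := ha.strictMono hij
            have h2 := hb.strictMono hij
            by_cases hi : s ≤ i
            · simpa [ha', hi, hi.trans hij.le] using h2
            · by_cases hj : s ≤ j
              · have h3 := h i (not_le.1 hi)
                simp only [ha', hi, hj, if_true, if_false]
                omega
              · simpa [ha', hi, hj] using h1
          · rcases hcases i with h1 | h1 <;> rw [h1.1]
            exacts [ha.one_le i, hb.one_le i]
          · rcases hcases i with h1 | h1 <;> rw [h1.1]
            exacts [ha.le i, hb.le i]
        have hbc : IsColumn k m b' := by
          refine ⟨fun i j hij => ?_, fun i => ?_, fun i => ?_⟩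
          · have h1 := ha.strictMono hij
            have h2 := hb.strictMono hij
            by_cases hi : s ≤ i
            · simpa [hb', hi, hi.trans hij.le] using h1
            · by_cases hj : s ≤ j
              · have h3 := hb.strictMono (not_le.1 hi)
                have h4 := ha.strictMono.monotone hj
                simp only [hb', hi, hj, if_true, if_false]
                omega
              · simpa [hb', hi, hj] using h2
          · rcases hcases i with h1 | h1 <;> rw [h1.2]
            exacts [hb.one_le i, ha.one_le i]
          · rcases hcases i with h1 | h1 <;> rw [h1.2]
            exacts [hb.le i, ha.le i]
        have hinf : a' ⊓ b' = a ⊓ b := by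
          ext i
          rcases hcases i with h1 | h1 <;> simp [h1.1, h1.2, min_comm]
        have hsup : a' ⊔ b' = a ⊔ b := by
          ext i
          rcases hcases i with h1 | h1 <;> simp [h1.1, h1.2, max_comm]
        have hab' : (∃ i, a' i ≤ m) ∨ ∃ i, b' i ≤ m := by
          rcases hab with ⟨i, hi⟩ | ⟨i, hi⟩ <;> rcases hcases i with h1 | h1
          · exact Or.inl ⟨i, h1.1 ▸ hi⟩
          · exact Or.inr ⟨i, h1.2 ▸ hi⟩
          · exact Or.inr ⟨i, h1.2 ▸ hi⟩
          · exact Or.inl ⟨i, h1.1 ▸ hi⟩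
        have hih := ih (r + 1) (by omega) hac hbc hab' fun i hi => by
          rcases Nat.lt_succ_iff_lt_or_eq.1 hi with h1 | h1
          · have : ¬ s ≤ i := not_le.2 h1
            simpa [ha', hb', this] using h i h1
          · have : i = s := Fin.ext h1
            simpa [ha', hb', this] using hlt.le
        rw [hinf, hsup, colWeight_add_congr hcases] at hih
        simpa using add_mem hswap hih
  exact key k 0 (by omega) ha hb hab fun i hi => by omega
/-- `F` precedes `G` : the least element where they differ belongs to `F`. -/
def LexBefore (F G : Finset ℕ) : Prop :=
  ∃ a ∈ F, a ∉ G ∧ ∀ b < a, b ∈ F ↔ b ∈ G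

section SquareZero

variable {T : Type*} [CommRing T] [Algebra ℂ T]

/-- Squarefree monomials in `w s, …, w (n - 1)` of the same degree as `F` and lexicographically
after it. -/
def laterMonomials (w : ℕ → T) (n s : ℕ) (F : Finset ℕ) : Set T :=
  {z | ∃ G : Finset ℕ, G ⊆ Finset.Ico s n ∧ G.card = F.card ∧ LexBefore F G ∧ z = ∏ u ∈ G, w u}

theorem mul_prod_mem_of_insert {w : ℕ → T} (hw : ∀ u, w u * w u = 0) (P : Submodule ℂ T) (u : ℕ)
    (G : Finset ℕ) (h : u ∉ G → ∏ v ∈ insert u G, w v ∈ P) : w u * ∏ v ∈ G, w v ∈ P := by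
  by_cases hu : u ∈ G
  · rw [← Finset.mul_prod_erase G w hu, ← mul_assoc, hw, zero_mul]
    exact zero_mem _
  · rw [← Finset.prod_insert hu]
    exact h hu

theorem span_mul_left_le (x : T) (A : Set T) (P : Submodule ℂ T) (h : ∀ z ∈ A, x * z ∈ P) {z : T}
    (hz : z ∈ Submodule.span ℂ A) : x * z ∈ P := by
  have : Submodule.span ℂ A ≤ P.comap (LinearMap.mulLeft ℂ x) := Submodule.span_le.2 h
  exact this hz

theorem lexBefore_of_min {F G : Finset ℕ} {s n : ℕ} (hF : F ⊆ Finset.Ico s n) (hs : s ∈ F)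
    (hG : G ⊆ Finset.Ico (s + 1) n) : LexBefore F G := by
  refine ⟨s, hs, fun h => ?_, fun b hb => ⟨fun h => ?_, fun h => ?_⟩⟩
  · have := Finset.mem_Ico.1 (hG h); omega
  · have := Finset.mem_Ico.1 (hF h); omega
  · have := Finset.mem_Ico.1 (hG h); omega

/-- A monomial violating the ballot condition is a combination of later monomials modulo
a power of the sum of the variables. -/
theorem exists_later_of_unbalanced {w : ℕ → T} (hw : ∀ u, w u * w u = 0) {H : Finset ℕ}
    (hH : ∀ u ∈ H, w u = 0) (n : ℕ) :
    ∀ d s : ℕ, s + d = n → ∀ (p : ℕ) (F : Finset ℕ), F ⊆ Finset.Ico s n → Disjoint F H →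
      (p = 0 ∨ ∃ t, s ≤ t ∧ t ≤ n ∧ t - s + p ≤
        ∑ u ∈ Finset.Ico s t, if u ∈ F then 2 else if u ∈ H then 1 else 0) →
      ∃ g z : T, z ∈ Submodule.span ℂ (laterMonomials w n s F) ∧
        ∏ u ∈ F, w u = z + g * (∑ u ∈ Finset.Ico s n, w u) ^ p := by
  intro d
  induction d with
  | zero =>
    rintro s hs p F hF hFH (rfl | ⟨t, h1, h2, h3⟩)
    · exact ⟨∏ u ∈ F, w u, 0, zero_mem _, by simp⟩
    · have : t = s := by omega
      subst this
      have hp : p = 0 := by simpa using h3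
      subst hp
      exact ⟨∏ u ∈ F, w u, 0, zero_mem _, by simp⟩
  | succ d ih =>
    intro s hs p F hF hFH hbad
    rcases Nat.eq_zero_or_pos p with rfl | hp
    · exact ⟨∏ u ∈ F, w u, 0, zero_mem _, by simp⟩
    obtain ⟨t, hst, htn, hsum⟩ := hbad.resolve_left hp.ne'
    have hst' : s < t := by
      rcases hst.lt_or_eq with h | h
      · exact h
      · subst h; simp at hsum; omega
    rw [Finset.sum_eq_sum_Ico_succ_bot hst'] at hsum
    have hσ : ∑ u ∈ Finset.Ico s n, w u = w s + ∑ u ∈ Finset.Ico (s + 1) n, w u :=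
      Finset.sum_eq_sum_Ico_succ_bot (by omega) _
    have hmono : ∀ F : Finset ℕ, Submodule.span ℂ (laterMonomials w n (s + 1) F) ≤
        Submodule.span ℂ (laterMonomials w n s F) := fun F => by
      refine Submodule.span_mono ?_
      rintro z ⟨G, hG, hrest⟩
      exact ⟨G, hG.trans (Finset.Ico_subset_Ico_left (by omega)), hrest⟩
    have hsub : s ∉ F → F ⊆ Finset.Ico (s + 1) n := fun hsF u hu => by
      have h1 := Finset.mem_Ico.1 (hF hu)
      have h2 : u ≠ s := fun h => hsF (h ▸ hu)
      exact Finset.mem_Ico.2 ⟨by omega, h1.2⟩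
    by_cases hsF : s ∈ F
    · -- `s` is a full pair
      rw [if_pos hsF] at hsum
      obtain ⟨q, rfl⟩ : ∃ q, p = q + 1 := ⟨p - 1, by omega⟩
      have hGsub : F.erase s ⊆ Finset.Ico (s + 1) n := fun u hu => by
        have h1 := Finset.mem_Ico.1 (hF (Finset.mem_of_mem_erase hu))
        have h2 := Finset.ne_of_mem_erase hu
        exact Finset.mem_Ico.2 ⟨by omega, h1.2⟩
      have hcard : (F.erase s).card + 1 = F.card := Finset.card_erase_add_one hsF
      have hbad' : q = 0 ∨ ∃ t, s + 1 ≤ t ∧ t ≤ n ∧ t - (s + 1) + q ≤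
          ∑ u ∈ Finset.Ico (s + 1) t, if u ∈ F.erase s then 2 else if u ∈ H then 1 else 0 := by
        refine Or.inr ⟨t, hst', htn, ?_⟩
        have : ∑ u ∈ Finset.Ico (s + 1) t,
            (if u ∈ F.erase s then 2 else if u ∈ H then 1 else 0) =
            ∑ u ∈ Finset.Ico (s + 1) t, if u ∈ F then 2 else if u ∈ H then 1 else 0 := by
          refine Finset.sum_congr rfl fun u hu => ?_
          have h2 : u ≠ s := by have := Finset.mem_Ico.1 hu; omega
          simp [h2]
        rw [this]
        omega
      obtain ⟨g, z, hz, hg⟩ := ih (s + 1) (by omega) q (F.erase s) hGsub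
        (hFH.mono_left (Finset.erase_subset _ _)) hbad'
      set τ := ∑ u ∈ Finset.Ico (s + 1) n, w u with hτ
      have hq : ((q : ℂ) + 1) ≠ 0 := by exact_mod_cast Nat.succ_ne_zero q
      refine ⟨((q : ℂ) + 1)⁻¹ • g, w s * z - ((q : ℂ) + 1)⁻¹ • (τ * (∏ u ∈ F.erase s, w u - z)),
        ?_, ?_⟩
      · have hτmul : ∀ G : Finset ℕ, G ⊆ Finset.Ico (s + 1) n → G.card = (F.erase s).card →
            τ * ∏ u ∈ G, w u ∈ Submodule.span ℂ (laterMonomials w n s F) := by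
          intro G hG hGc
          rw [hτ, Finset.sum_mul]
          refine Submodule.sum_mem _ fun u hu => mul_prod_mem_of_insert hw _ _ _ fun huG => ?_
          have hins : insert u G ⊆ Finset.Ico (s + 1) n := Finset.insert_subset hu hG
          refine Submodule.subset_span ⟨insert u G,
            hins.trans (Finset.Ico_subset_Ico_left (by omega)), ?_,
            lexBefore_of_min hF hsF hins, rfl⟩
          rw [Finset.card_insert_of_notMem huG]
          omega
        refine sub_mem ?_ (Submodule.smul_mem _ _ ?_)
        · refine span_mul_left_le _ _ _ ?_ hz
          rintro _ ⟨G, hG, hGc, ⟨a, haF, haG, hab⟩, rfl⟩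
          have hsG : s ∉ G := fun h => by have := Finset.mem_Ico.1 (hG h); omega
          rw [← Finset.prod_insert hsG]
          refine Submodule.subset_span ⟨insert s G, ?_, ?_, ⟨a, Finset.mem_of_mem_erase haF, ?_, ?_⟩,
            rfl⟩
          · exact Finset.insert_subset (hF hsF)
              (hG.trans (Finset.Ico_subset_Ico_left (by omega)))
          · rw [Finset.card_insert_of_notMem hsG]; omega
          · simp [haG, Finset.ne_of_mem_erase haF]
          · intro b hb
            have := hab b hb
            by_cases hbs : b = s
            · simp [hbs, hsF]
            · simpa [hbs] using this
        · rw [mul_sub]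
          refine sub_mem (hτmul _ hGsub rfl) (span_mul_left_le _ _ _ ?_ hz)
          rintro _ ⟨G, hG, hGc, -, rfl⟩
          exact hτmul G hG hGc
      · have hsq : ∀ r : ℕ, (w s + τ) ^ (r + 1) = τ ^ (r + 1) + (r + 1 : ℕ) * w s * τ ^ r := by
          intro r
          induction r with
          | zero => simp; ring
          | succ r ihr =>
            rw [pow_succ, ihr]
            push_cast
            linear_combination ((r : T) + 1) * τ ^ r * hw s
        have hF' : ∏ u ∈ F, w u = w s * ∏ u ∈ F.erase s, w u :=
          (Finset.mul_prod_erase F w hsF).symm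
        have hinv : algebraMap ℂ T ((q : ℂ) + 1)⁻¹ * ((q : T) + 1) = 1 := by
          have : ((q : T) + 1) = algebraMap ℂ T ((q : ℂ) + 1) := by simp
          rw [this, ← map_mul, inv_mul_cancel₀ hq, map_one]
        rw [hσ, hsq, hF', hg, add_sub_cancel_left, Algebra.smul_def, Algebra.smul_def]
        push_cast
        linear_combination (-(g * w s * τ ^ q)) * hinv
    · have hFsub := hsub hsF
      rw [if_neg hsF] at hsum
      by_cases hsH : s ∈ H
      · -- `s` is a half pair
        rw [if_pos hsH] at hsum
        obtain ⟨g, z, hz, hg⟩ := ih (s + 1) (by omega) p F hFsub hFH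
          (Or.inr ⟨t, hst', htn, by omega⟩)
        exact ⟨g, z, hmono _ hz, by rw [hσ, hH s hsH, zero_add, hg]⟩
      · -- `s` is an empty pair
        rw [if_neg hsH] at hsum
        obtain ⟨g, z, hz, hg⟩ := ih (s + 1) (by omega) (p + 1) F hFsub hFH
          (Or.inr ⟨t, hst', htn, by omega⟩)
        have hsq : ∀ r : ℕ, ∑ u ∈ Finset.Ico (s + 1) n, w u = (∑ u ∈ Finset.Ico s n, w u) - w s ∧
            ((∑ u ∈ Finset.Ico s n, w u) - w s) ^ (r + 1) =
              (∑ u ∈ Finset.Ico s n, w u) ^ r *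
                ((∑ u ∈ Finset.Ico s n, w u) - (r + 1 : ℕ) * w s) := by
          intro r
          refine ⟨by rw [hσ]; ring, ?_⟩
          induction r with
          | zero => simp
          | succ r ihr =>
            rw [pow_succ, ihr]
            push_cast
            linear_combination ((r : T) + 1) * (∑ u ∈ Finset.Ico s n, w u) ^ r * hw s
        refine ⟨g * ((∑ u ∈ Finset.Ico s n, w u) - (p + 1 : ℕ) * w s), z, hmono _ hz, ?_⟩
        rw [hg, (hsq p).1, (hsq p).2]
        ring

end SquareZero

section Wedge

variable {k : ℕ} {A : Type} [CommRing A]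

open ExteriorAlgebra in
/-- The product in the exterior algebra of the vectors indexed by the entries of `l`. -/
def wedge (c : ℕ → Fin k → A) (l : List ℕ) : ExteriorAlgebra A (Fin k → A) :=
  (l.map fun a => ι A (c a)).prod

theorem wedge_append (c : ℕ → Fin k → A) (l l' : List ℕ) :
    wedge c (l ++ l') = wedge c l * wedge c l' := by
  simp [wedge]

theorem wedge_eq_ιMulti (c : ℕ → Fin k → A) (l : List ℕ) :
    wedge c l = ExteriorAlgebra.ιMulti A l.length (fun i => c (l.get i)) := by
  rw [ExteriorAlgebra.ιMulti_apply, wedge]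
  congr 1
  exact (List.ofFn_getElem (xs := l.map fun a => ExteriorAlgebra.ι A (c a))).symm.trans
    (List.ext_getElem (by simp) (by simp))

theorem wedge_eq_zero (c : ℕ → Fin k → A) {l : List ℕ} (hl : ¬ l.Nodup) : wedge c l = 0 := by
  rw [wedge_eq_ιMulti]
  apply AlternatingMap.map_eq_zero_of_not_injective
  intro h
  exact hl (List.nodup_iff_injective_get.2 (Function.Injective.of_comp h))

/-- The linear functional sending a wedge of `k` vectors in `A ^ k` to their determinant. -/
def detFunctional (k : ℕ) (A : Type) [CommRing A] : ExteriorAlgebra A (Fin k → A) →ₗ[A] A :=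
  ExteriorAlgebra.liftAlternating fun i =>
    if h : k = i then (Matrix.detRowAlternating (n := Fin k) (R := A)).domDomCongr (finCongr h)
    else 0

theorem detFunctional_wedge (c : ℕ → Fin k → A) {l : List ℕ} (hl : l.length = k) :
    detFunctional k A (wedge c l) = maxMinor c (fun i => l.get (i.cast hl.symm)) := by
  rw [wedge_eq_ιMulti, detFunctional, ExteriorAlgebra.liftAlternating_apply_ιMulti,
    dif_pos hl.symm]
  rfl

/-- The wedge of the two vectors paired by the symplectic form. -/
def pairWedge (c : ℕ → Fin k → A) (u : ℕ) : ExteriorAlgebra A (Fin k → A) :=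
  wedge c [2 * u + 1, 2 * u + 2]

theorem pairWedge_mem_center [Algebra ℂ A] (c : ℕ → Fin k → A) (u : ℕ) :
    pairWedge c u ∈ Subalgebra.center ℂ (ExteriorAlgebra A (Fin k → A)) := by
  rw [Subalgebra.mem_center_iff]
  intro b
  induction b using ExteriorAlgebra.induction with
  | algebraMap r => exact Algebra.commutes _ _
  | ι x =>
    have h1 := ExteriorAlgebra.ι_add_mul_swap (R := A) x (c (2 * u + 1))
    have h2 := ExteriorAlgebra.ι_add_mul_swap (R := A) x (c (2 * u + 2))
    rw [add_eq_zero_iff_eq_neg] at h1 h2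
    simp only [pairWedge, wedge, List.map_cons, List.map_nil, List.prod_cons, List.prod_nil,
      mul_one]
    rw [← mul_assoc, h1, neg_mul, mul_assoc, h2, mul_neg, neg_neg, mul_assoc]
  | mul a b ha hb => rw [mul_assoc, hb, ← mul_assoc, ha, mul_assoc]
  | add a b ha hb => rw [add_mul, mul_add, ha, hb]

/-- The sum of the paired wedges vanishes when the columns satisfy the symplectic relations. -/
theorem sum_pairWedge [Algebra ℂ A] (c : ℕ → Fin k → A) (n : ℕ)
    (hc : ∀ i j, ∑ u ∈ Finset.range n,
      (c (2 * u + 1) i * c (2 * u + 2) j - c (2 * u + 1) j * c (2 * u + 2) i) = 0) :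
    ∑ u ∈ Finset.range n, pairWedge c u = 0 := by
  set e : Fin k → ExteriorAlgebra A (Fin k → A) :=
    fun i => ExteriorAlgebra.ι A (Pi.single i (1 : A)) with he
  have hι (v : Fin k → A) : ExteriorAlgebra.ι A v = ∑ i, v i • e i := by
    conv_lhs => rw [pi_eq_sum_univ' v]
    simp only [map_sum, map_smul, he]
  set B : Fin k → Fin k → A := fun i j =>
    ∑ u ∈ Finset.range n, c (2 * u + 1) i * c (2 * u + 2) j with hB
  have hsymm (i j) : B i j = B j i := by
    have := hc i j
    rw [Finset.sum_sub_distrib, sub_eq_zero] at this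
    exact this
  have hS : ∑ u ∈ Finset.range n, pairWedge c u = ∑ i, ∑ j, B i j • (e i * e j) := by
    simp only [hB, Finset.sum_smul]
    simp_rw [Finset.sum_comm (t := Finset.range n)]
    refine Finset.sum_congr rfl fun u _ => ?_
    simp only [pairWedge, wedge, List.map_cons, List.map_nil, List.prod_cons, List.prod_nil,
      mul_one, hι, Finset.sum_mul_sum, smul_mul_smul_comm]
  have hneg : ∑ i, ∑ j, B i j • (e i * e j) = -∑ i, ∑ j, B i j • (e i * e j) := by
    conv_lhs => rw [Finset.sum_comm]
    simp only [← Finset.sum_neg_distrib]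
    refine Finset.sum_congr rfl fun i _ => Finset.sum_congr rfl fun j _ => ?_
    rw [hsymm j i, ← smul_neg]
    congr 1
    exact eq_neg_of_add_eq_zero_left (ExteriorAlgebra.ι_add_mul_swap _ _)
  rw [hS]
  set S := ∑ i, ∑ j, B i j • (e i * e j)
  have h2 : (2 : ℂ) • S = 0 := by
    rw [two_smul]
    nth_rw 1 [hneg]
    exact neg_add_cancel S
  exact (smul_eq_zero_iff_right (two_ne_zero)).1 h2

/-- The list of paired entries indexed by `G`. -/
def pairList (G : Finset ℕ) : List ℕ := G.toList.flatMap fun u => [2 * u + 1, 2 * u + 2]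

theorem mem_pairList {G : Finset ℕ} {v : ℕ} :
    v ∈ pairList G ↔ 1 ≤ v ∧ (v - 1) / 2 ∈ G := by
  simp only [pairList, List.mem_flatMap, Finset.mem_toList, List.mem_cons, List.not_mem_nil,
    or_false]
  constructor
  · rintro ⟨u, hu, rfl | rfl⟩
    · exact ⟨by omega, by rwa [show (2 * u + 1 - 1) / 2 = u by omega]⟩
    · exact ⟨by omega, by rwa [show (2 * u + 2 - 1) / 2 = u by omega]⟩
  · rintro ⟨h1, h2⟩
    exact ⟨_, h2, by omega⟩

theorem length_pairList (G : Finset ℕ) : (pairList G).length = 2 * G.card := by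
  simp [pairList, List.length_flatMap, mul_comm]

theorem wedge_pairList (c : ℕ → Fin k → A) (G : Finset ℕ) :
    wedge c (pairList G) = (G.toList.map (pairWedge c)).prod := by
  rw [pairList]
  induction G.toList with
  | nil => simp [wedge]
  | cons a l ih =>
    rw [List.flatMap_cons, wedge_append, ih, List.map_cons, List.prod_cons, pairWedge]

/-- A maximal minor violating the ballot condition of `J̃` is, modulo the symplectic relations,
a combination of maximal minors of smaller weight. -/
theorem exists_lower_of_not_ballot [Algebra ℂ A] {n M : ℕ} (hM : 2 * (2 * n) < M)
    (c : ℕ → Fin k → A)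
    (hc : ∀ i j, ∑ u ∈ Finset.range n,
      (c (2 * u + 1) i * c (2 * u + 2) j - c (2 * u + 1) j * c (2 * u + 2) i) = 0)
    {q : Fin k → ℕ} (hq : IsColumn k (2 * n) q) (r : Fin k) (hr : q r ≤ 2 * r ∧ q r ≤ 2 * n) :
    maxMinor c q ∈ Submodule.span ℂ {z | ∃ x, IsColumn k (2 * n) x ∧
      colWeight k (2 * n) M x < colWeight k (2 * n) M q ∧ (∃ i, x i ≤ 2 * n) ∧
      z = maxMinor c x} := by
  classical
  set P := Submodule.span ℂ {z | ∃ x, IsColumn k (2 * n) x ∧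
      colWeight k (2 * n) M x < colWeight k (2 * n) M q ∧ (∃ i, x i ≤ 2 * n) ∧
      z = maxMinor c x}
  set Q : Finset ℕ := Finset.univ.image q with hQ
  have hQmem (v : ℕ) : v ∈ Q ↔ v ∈ Set.range q := by simp [hQ]
  have hQcard : Q.card = k := by
    rw [hQ, Finset.card_image_of_injective _ hq.strictMono.injective, Finset.card_fin]
  have hQ1 (v : ℕ) (hv : v ∈ Q) : 1 ≤ v ∧ v ≤ 2 * n + k := by
    obtain ⟨i, rfl⟩ := (hQmem v).1 hv
    exact ⟨hq.one_le i, hq.le i⟩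
  set F : Finset ℕ := (Finset.range n).filter fun u => 2 * u + 1 ∈ Q ∧ 2 * u + 2 ∈ Q with hF
  set H : Finset ℕ := (Finset.range n).filter fun u =>
    (2 * u + 1 ∈ Q ∨ 2 * u + 2 ∈ Q) ∧ ¬ (2 * u + 1 ∈ Q ∧ 2 * u + 2 ∈ Q) with hH
  set S : Finset ℕ := Q.filter fun v => (v - 1) / 2 ∉ F with hS
  have hFS (v : ℕ) : v ∈ Q ↔ v ∈ pairList F ++ S.toList := by
    simp only [List.mem_append, mem_pairList, Finset.mem_toList, hS, Finset.mem_filter]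
    constructor
    · intro hv
      by_cases h : (v - 1) / 2 ∈ F
      · exact Or.inl ⟨(hQ1 v hv).1, h⟩
      · exact Or.inr ⟨hv, h⟩
    · rintro (⟨h1, h2⟩ | h)
      · have h3 := (Finset.mem_filter.1 h2).2
        rcases Nat.even_or_odd' (v - 1) with ⟨b, hb | hb⟩
        · rw [show 2 * ((v - 1) / 2) + 1 = v by omega] at h3
          exact h3.1
        · rw [show 2 * ((v - 1) / 2) + 2 = v by omega] at h3
          exact h3.2
      · exact h.1
  have hnodup : (pairList F ++ S.toList).Nodup := by
    refine List.nodup_append.2 ⟨?_, S.nodup_toList, ?_⟩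
    · rw [pairList, List.nodup_flatMap]
      refine ⟨fun u _ => by simp, F.nodup_toList.imp ?_⟩
      intro a b hab
      simp only [Function.onFun, List.disjoint_left, List.mem_cons, List.not_mem_nil, or_false]
      omega
    · rintro a ha b hb rfl
      exact (Finset.mem_filter.1 (Finset.mem_toList.1 hb)).2 (mem_pairList.1 ha).2
  have hlenF : 2 * F.card + S.card = k := by
    have h1 : (pairList F ++ S.toList).toFinset = Q := by
      ext v; rw [List.mem_toFinset, hFS]
    rw [← hQcard, ← h1, List.toFinset_card_of_nodup hnodup, List.length_append, length_pairList,
      Finset.length_toList]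
  have hlen (G : Finset ℕ) (hG : G.card = F.card) : (pairList G ++ S.toList).length = k := by
    rw [List.length_append, length_pairList, Finset.length_toList, hG, hlenF]
  set Z := wedge c S.toList with hZ
  have hprod (G : Finset ℕ) :
      wedge c (pairList G ++ S.toList) = (G.toList.map (pairWedge c)).prod * Z := by
    rw [wedge_append, wedge_pairList]
  have hHZ (u : ℕ) (hu : u ∈ H) : pairWedge c u * Z = 0 := by
    rw [pairWedge, hZ, ← wedge_append]
    refine wedge_eq_zero c fun hnd => ?_
    obtain ⟨_, h1, h2⟩ := Finset.mem_filter.1 hu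
    have huF : u ∉ F := fun h => h2 (Finset.mem_filter.1 h).2
    have hdis := (List.nodup_append.1 hnd).2.2
    rcases h1 with h | h
    · refine hdis (2 * u + 1) (by simp) (2 * u + 1) ?_ rfl
      rw [Finset.mem_toList, hS, Finset.mem_filter, show (2 * u + 1 - 1) / 2 = u by omega]
      exact ⟨h, huF⟩
    · refine hdis (2 * u + 2) (by simp) (2 * u + 2) ?_ rfl
      rw [Finset.mem_toList, hS, Finset.mem_filter, show (2 * u + 2 - 1) / 2 = u by omega]
      exact ⟨h, huF⟩
  set w : ℕ → Subalgebra.center ℂ (ExteriorAlgebra A (Fin k → A)) := fun u =>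
    if u ∈ H then 0 else ⟨pairWedge c u, pairWedge_mem_center c u⟩ with hw
  have hw2 (u : ℕ) : w u * w u = 0 := by
    by_cases hu : u ∈ H
    · simp [hw, hu]
    · simp only [hw, hu, if_false]
      apply Subtype.ext
      change pairWedge c u * pairWedge c u = 0
      rw [pairWedge, ← wedge_append]
      exact wedge_eq_zero c (by simp)
  have hwH (u : ℕ) (hu : u ∈ H) : w u = 0 := by simp [hw, hu]
  have hwlist (l : List ℕ) : (∀ u ∈ l, u ∉ H) →
      (((l.map w).prod : Subalgebra.center ℂ (ExteriorAlgebra A (Fin k → A))) :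
        ExteriorAlgebra A (Fin k → A)) = (l.map (pairWedge c)).prod := by
    induction l with
    | nil => intro _; rfl
    | cons a l ih =>
      intro h
      rw [List.map_cons, List.prod_cons, List.map_cons, List.prod_cons,
        ← ih fun u hu => h u (List.mem_cons_of_mem _ hu)]
      simp [hw, h a List.mem_cons_self]
  have hwprod (G : Finset ℕ) (hG : Disjoint G H) :
      ((∏ u ∈ G, w u : Subalgebra.center ℂ (ExteriorAlgebra A (Fin k → A))) :
        ExteriorAlgebra A (Fin k → A)) * Z = wedge c (pairList G ++ S.toList) := by
    have h1 := Finset.prod_map_toList G w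
    rw [hprod, ← hwlist G.toList fun u hu =>
      Finset.disjoint_left.1 hG (Finset.mem_toList.1 hu), ← h1]
  have hFn (u : ℕ) (hu : u ∈ F) : u < n := Finset.mem_range.1 (Finset.mem_filter.1 hu).1
  have hFsub : F ⊆ Finset.Ico 0 n := fun u hu => Finset.mem_Ico.2 ⟨Nat.zero_le _, hFn u hu⟩
  have hFH : Disjoint F H := Finset.disjoint_left.2 fun u hu hu' =>
    (Finset.mem_filter.1 hu').2.2 (Finset.mem_filter.1 hu).2
  have hcount : ((q r + 1) / 2) - 0 + 1 ≤
      ∑ u ∈ Finset.Ico 0 ((q r + 1) / 2), if u ∈ F then 2 else if u ∈ H then 1 else 0 := by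
    have hmaps : Set.MapsTo (fun v => (v - 1) / 2) ((Finset.Iic r).image q : Finset ℕ)
        (Finset.Ico 0 ((q r + 1) / 2) : Finset ℕ) := by
      intro v hv
      obtain ⟨i, hi, rfl⟩ := Finset.mem_image.1 (Finset.mem_coe.1 hv)
      have h1 := hq.one_le i
      have h2 := hq.strictMono.monotone (Finset.mem_Iic.1 hi)
      refine Finset.mem_coe.2 (Finset.mem_Ico.2 ⟨Nat.zero_le _, ?_⟩)
      change (q i - 1) / 2 < _
      omega
    have h1 := Finset.card_eq_sum_card_fiberwise hmaps
    rw [Finset.card_image_of_injective _ hq.strictMono.injective, Fin.card_Iic] at h1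
    refine le_trans (b := (r : ℕ) + 1) (by omega) (h1.trans_le (Finset.sum_le_sum fun u hu => ?_))
    have hun : u < n := by have := (Finset.mem_Ico.1 hu).2; omega
    have hsub : ((Finset.Iic r).image q).filter (fun v => (v - 1) / 2 = u) ⊆
        ({2 * u + 1, 2 * u + 2} : Finset ℕ).filter (· ∈ Q) := by
      intro v hv
      obtain ⟨h2, h3⟩ := Finset.mem_filter.1 hv
      obtain ⟨i, _, rfl⟩ := Finset.mem_image.1 h2
      have h4 := hq.one_le i
      refine Finset.mem_filter.2 ⟨?_, Finset.mem_image_of_mem q (Finset.mem_univ i)⟩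
      simp only [Finset.mem_insert, Finset.mem_singleton]
      omega
    refine (Finset.card_le_card hsub).trans ?_
    rw [Finset.filter_insert, Finset.filter_singleton]
    have hFu : u ∈ F ↔ 2 * u + 1 ∈ Q ∧ 2 * u + 2 ∈ Q := by simp [hF, hun]
    have hHu : u ∈ H ↔ (2 * u + 1 ∈ Q ∨ 2 * u + 2 ∈ Q) ∧ ¬ (2 * u + 1 ∈ Q ∧ 2 * u + 2 ∈ Q) := by
      simp [hH, hun]
    by_cases h3 : 2 * u + 1 ∈ Q <;> by_cases h4 : 2 * u + 2 ∈ Q <;> simp [hFu, hHu, h3, h4]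
  obtain ⟨g, z, hz, hid⟩ := exists_later_of_unbalanced hw2 hwH n n 0 (by omega) 1 F hFsub hFH
    (Or.inr ⟨(q r + 1) / 2, Nat.zero_le _, by omega, hcount⟩)
  have hσ : ((∑ u ∈ Finset.Ico 0 n, w u :
      Subalgebra.center ℂ (ExteriorAlgebra A (Fin k → A))) :
        ExteriorAlgebra A (Fin k → A)) * Z = 0 := by
    rw [AddSubmonoidClass.coe_finsetSum, Finset.sum_mul]
    rw [← zero_mul Z, ← sum_pairWedge c n hc, Finset.sum_mul, Nat.Ico_zero_eq_range]
    refine Finset.sum_congr rfl fun u _ => ?_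
    by_cases hu : u ∈ H
    · simp [hw, hu, hHZ u hu]
    · simp [hw, hu]
  set φ : Subalgebra.center ℂ (ExteriorAlgebra A (Fin k → A)) →ₗ[ℂ] A :=
    ((detFunctional k A).restrictScalars ℂ) ∘ₗ (LinearMap.mulRight ℂ Z) ∘ₗ
      (Subalgebra.val _).toLinearMap with hφ
  have hφapp (x) : φ x = detFunctional k A ((x : ExteriorAlgebra A (Fin k → A)) * Z) := rfl
  have hφσ : φ (g * (∑ u ∈ Finset.Ico 0 n, w u) ^ 1) = 0 := by
    rw [hφapp, pow_one, MulMemClass.coe_mul, mul_assoc, hσ, mul_zero, map_zero]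
  have hφG (G : Finset ℕ) (hG : Disjoint G H) (hcard : G.card = F.card) :
      φ (∏ u ∈ G, w u) = maxMinor c (fun i =>
        (pairList G ++ S.toList).get (i.cast (hlen G hcard).symm)) := by
    rw [hφapp, hwprod G hG, detFunctional_wedge c (hlen G hcard)]
  have hrange (G : Finset ℕ) (hcard : G.card = F.card) (v : ℕ) :
      v ∈ Set.range (fun i : Fin k =>
        (pairList G ++ S.toList).get (i.cast (hlen G hcard).symm)) ↔
      v ∈ pairList G ++ S.toList := by
    rw [List.mem_iff_get]
    constructor
    · rintro ⟨i, hi⟩; exact ⟨_, hi⟩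
    · rintro ⟨i, hi⟩; exact ⟨i.cast (hlen G hcard), hi⟩
  have hφF : φ (∏ u ∈ F, w u) ∈ P → maxMinor c q ∈ P := by
    rw [hφG F hFH rfl]
    obtain ⟨x, hx, hxr, hxc⟩ := exists_sorted_maxMinor (q := fun i : Fin k =>
      (pairList F ++ S.toList).get (i.cast (hlen F rfl).symm))
      ((List.nodup_iff_injective_get.1 hnodup).comp (Fin.cast_injective _))
    have hxq : x = q := by
      refine (StrictMono.range_inj hx hq.strictMono).1 (hxr.trans (Set.ext fun v => ?_))
      rw [hrange F rfl, ← hFS, hQmem]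
    subst hxq
    rcases hxc c with h | h
    · rw [h]; exact id
    · rw [h]; exact fun h => by simpa using neg_mem h
  have hφz : φ z ∈ P := by
    have hle : Submodule.span ℂ (laterMonomials w n 0 F) ≤ P.comap φ := by
      refine Submodule.span_le.2 ?_
      rintro _ ⟨G, hGn, hcard, ⟨a, haF, haG, hab⟩, rfl⟩
      change φ _ ∈ P
      by_cases hG : Disjoint G H
      swap
      · obtain ⟨u, huG, huH⟩ := Finset.not_disjoint_iff.1 hG
        rw [Finset.prod_eq_zero huG (hwH u huH), map_zero]
        exact zero_mem _
      rw [hφG G hG hcard]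
      by_cases hinj : Function.Injective (fun i : Fin k =>
        (pairList G ++ S.toList).get (i.cast (hlen G hcard).symm))
      swap
      · rw [maxMinor_eq_zero c hinj]
        exact zero_mem _
      obtain ⟨x, hx, hxr, hxc⟩ := exists_sorted_maxMinor hinj
      have hxmem (v : ℕ) : v ∈ Set.range x ↔ v ∈ pairList G ++ S.toList := by
        rw [hxr, hrange G hcard]
      have hxmem' (v : ℕ) : v ∈ Set.range x ↔ (1 ≤ v ∧ (v - 1) / 2 ∈ G) ∨ v ∈ S := by
        rw [hxmem, List.mem_append, mem_pairList, Finset.mem_toList]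
      have hqmem' (v : ℕ) : v ∈ Set.range q ↔ (1 ≤ v ∧ (v - 1) / 2 ∈ F) ∨ v ∈ S := by
        rw [← hQmem, hFS, List.mem_append, mem_pairList, Finset.mem_toList]
      have hxcol : IsColumn k (2 * n) x := by
        have key (i : Fin k) : 1 ≤ x i ∧ x i ≤ 2 * n + k := by
          rcases (hxmem' (x i)).1 ⟨i, rfl⟩ with ⟨h1, h2⟩ | h
          · have := (Finset.mem_Ico.1 (hGn h2)).2
            omega
          · exact hQ1 _ (Finset.mem_filter.1 h).1
        exact ⟨hx, fun i => (key i).1, fun i => (key i).2⟩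
      obtain ⟨t, ht⟩ : 2 * a + 1 ∈ Set.range q := (hqmem' _).2 (Or.inl ⟨by omega, by
        rwa [show (2 * a + 1 - 1) / 2 = a by omega]⟩)
      have hlt := lt_of_range_agree hx hq.strictMono t (fun v hv => by
        rw [hqmem', hxmem']
        by_cases h1 : 1 ≤ v
        · rw [hab ((v - 1) / 2) (by omega)]
        · simp [h1]) (by
        rw [ht, hxmem', show (2 * a + 1 - 1) / 2 = a by omega]
        rintro (h | h)
        · exact haG h.2
        · refine (Finset.mem_filter.1 h).2 ?_
          rwa [show (2 * a + 1 - 1) / 2 = a by omega])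
      have hxP : maxMinor c x ∈ P := by
        refine Submodule.subset_span ⟨x, hxcol, colWeight_lt hM hxcol t hlt.1 hlt.2, ?_, rfl⟩
        have hne : G.Nonempty := by
          rw [← Finset.card_pos, hcard]
          exact Finset.card_pos.2 ⟨a, haF⟩
        obtain ⟨u, hu⟩ := hne
        obtain ⟨i, hi⟩ := (hxmem' (2 * u + 1)).2 (Or.inl ⟨by omega, by
          rwa [show (2 * u + 1 - 1) / 2 = u by omega]⟩)
        have := (Finset.mem_Ico.1 (hGn hu)).2
        exact ⟨i, by omega⟩
      rcases hxc c with h | h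
      · rw [h]; exact hxP
      · rw [h]; exact neg_mem hxP
    exact hle hz
  apply hφF
  rw [hid, map_add, hφσ, add_zero]
  exact hφz

end Wedge

section Dictionary

theorem det_of_last_row_unit {R : Type*} [CommRing R] {N : ℕ}
    (A : Matrix (Fin (N + 1)) (Fin (N + 1)) R) (i₀ : Fin (N + 1))
    (hA : ∀ j, A (Fin.last N) j = if j = i₀ then (-1) ^ (N - (i₀ : ℕ)) else 0) :
    A.det = (A.submatrix (Fin.last N).succAbove i₀.succAbove).det := by
  rw [Matrix.det_succ_row A (Fin.last N), Finset.sum_eq_single i₀]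
  · rw [hA, if_pos rfl, ← pow_add, Even.neg_one_pow, one_mul]
    have := i₀.isLt
    rw [Fin.val_last]
    exact ⟨N, by omega⟩
  · intro j _ hj
    rw [hA, if_neg hj, mul_zero, zero_mul]
  · simp

theorem det_of_unit_rows {R : Type*} [CommRing R] {h : ℕ} : ∀ (t : ℕ)
    (A : Matrix (Fin (h + t)) (Fin (h + t)) R) (g : Fin t → Fin (h + t)) (f : Fin h → Fin (h + t)),
    StrictAnti g → StrictMono f → (∀ a s, f a ≠ g s) →
    (∀ s i, A (Fin.natAdd h s) i = if i = g s then (-1) ^ (h + t - 1 - (g s : ℕ)) else 0) →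
    A.det = (A.submatrix (Fin.castAdd t) f).det := by
  intro t
  induction t with
  | zero =>
    intro A g f _ hf _ _
    have h1 : f = Fin.castAdd 0 := by
      have : f = id := by
        refine (StrictMono.range_inj hf strictMono_id).1 ?_
        rw [Set.range_id, (Finite.injective_iff_surjective.1 hf.injective).range_eq]
      exact this
    rw [h1]
    rfl
  | succ t ih =>
    intro A g f hg hf hfg hA
    set i₀ := g (Fin.last t) with hi₀
    have hlt (s : Fin t) : i₀ < g s.castSucc := hg (Fin.castSucc_lt_last s)
    have hg' (s : Fin t) : ∃ j : Fin (h + t), i₀.succAbove j = g s.castSucc :=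
      Fin.exists_succAbove_eq (hlt s).ne'
    have hf' (a : Fin h) : ∃ j : Fin (h + t), i₀.succAbove j = f a :=
      Fin.exists_succAbove_eq (hfg a _)
    choose g' hg' using hg'
    choose f' hf' using hf'
    have hval (s : Fin t) : (g s.castSucc : ℕ) = g' s + 1 := by
      have h1 := hlt s
      rw [← hg' s] at h1 ⊢
      rw [Fin.succAbove_of_le_castSucc _ _ ((Fin.lt_succAbove_iff_le_castSucc _ _).1 h1),
        Fin.val_succ]
    have hsub := ih (A.submatrix (Fin.last (h + t)).succAbove i₀.succAbove) g' f'
      (fun s s' hs => by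
        rw [← Fin.succAbove_lt_succAbove_iff (p := i₀), hg', hg']
        exact hg (Fin.castSucc_lt_castSucc_iff.2 hs))
      (fun a a' ha => by
        rw [← Fin.succAbove_lt_succAbove_iff (p := i₀), hf', hf']
        exact hf ha)
      (fun a s he => hfg a s.castSucc (by rw [← hf', ← hg', he]))
      (fun s i => by
        have h1 : (Fin.last (h + t)).succAbove (Fin.natAdd h s) = Fin.natAdd h s.castSucc := by
          rw [Fin.succAbove_last]; rfl
        have h2 : i₀.succAbove i = g s.castSucc ↔ i = g' s := by
          rw [← hg', Fin.succAbove_right_inj]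
        rw [Matrix.submatrix_apply, h1, hA, hval s]
        refine if_congr h2 ?_ rfl
        congr 1
        omega)
    have hdet := det_of_last_row_unit (N := h + t) A i₀ fun j => hA (Fin.last t) j
    rw [hdet, hsub, Matrix.submatrix_submatrix]
    congr 1
    refine Matrix.ext fun a b => ?_
    simp only [Matrix.submatrix_apply, Function.comp_apply, hf']
    rw [Fin.succAbove_last]
    rfl

/-- The columns of the generic `k × m` matrix, followed by signed unit columns. -/
def genCol (k m : ℕ) (c : ℕ) (i : Fin k) : MvPolynomial (Fin k × Fin m) ℂ :=
  if h : c - 1 < m then MvPolynomial.X (i, ⟨c - 1, h⟩)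
  else if c + i = m + k then (-1) ^ (c - m - 1) else 0

/-- The one-line tableau corresponding under `ξ` to the column `q`. -/
def colTab (k m : ℕ) (q : Fin k → ℕ) : List ℕ × List ℕ :=
  (xiInvI k m (List.ofFn q), xiInvJ m (List.ofFn q))

theorem sortedLT_range_add_one (n : ℕ) : ((List.range n).map (· + 1)).SortedLT := by
  apply List.Pairwise.sortedLT
  rw [List.pairwise_map]
  exact List.pairwise_lt_range.imp fun h => by omega

theorem mem_range_add_one {n c : ℕ} : c ∈ (List.range n).map (· + 1) ↔ 1 ≤ c ∧ c ≤ n := by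
  rw [List.mem_map]
  constructor
  · rintro ⟨a, ha, rfl⟩
    have := List.mem_range.1 ha
    omega
  · rintro ⟨h1, h2⟩
    exact ⟨c - 1, List.mem_range.2 (by omega), by omega⟩

theorem mem_xiInvI {k m i : ℕ} {K : List ℕ} :
    i ∈ xiInvI k m K ↔ (1 ≤ i ∧ i ≤ k) ∧ m + (k + 1 - i) ∉ K := by
  rw [xiInvI, List.mem_filter, mem_range_add_one, decide_eq_true_iff]

theorem mem_xiInvJ {m v : ℕ} {K : List ℕ} : v ∈ xiInvJ m K ↔ v ∈ K ∧ v ≤ m := by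
  rw [xiInvJ, List.mem_filter, decide_eq_true_iff]

theorem sortedLT_xiInvI (k m : ℕ) (K : List ℕ) : (xiInvI k m K).SortedLT :=
  ((sortedLT_range_add_one k).pairwise.filter _).sortedLT

theorem sortedLT_xiInvJ (m : ℕ) {K : List ℕ} (hK : K.SortedLT) : (xiInvJ m K).SortedLT :=
  (hK.pairwise.filter _).sortedLT

theorem mem_xi {k m v : ℕ} {I J : List ℕ} : v ∈ xi k m I J ↔
    v ∈ J ∨ ∃ c, (1 ≤ c ∧ c ≤ k) ∧ c ∉ I ∧ v = m + (k + 1 - c) := by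
  rw [xi, List.mem_append, List.mem_map]
  refine or_congr Iff.rfl (exists_congr fun c => ?_)
  rw [List.mem_reverse, List.mem_filter, mem_range_add_one, decide_eq_true_iff, and_assoc]
  exact and_congr_right fun _ => and_congr_right fun _ => eq_comm

theorem sortedLT_xi {k m : ℕ} {I J : List ℕ} (hJ : J.SortedLT) (hJm : ∀ v ∈ J, v ≤ m) :
    (xi k m I J).SortedLT := by
  apply List.Pairwise.sortedLT
  rw [xi, List.pairwise_append]
  refine ⟨hJ.pairwise, ?_, ?_⟩
  · rw [List.pairwise_map, List.pairwise_reverse]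
    refine List.Pairwise.imp_of_mem ?_ ((sortedLT_range_add_one k).pairwise.filter _)
    intro a b ha hb hab
    have h1 := mem_range_add_one.1 (List.mem_filter.1 ha).1
    have h2 := mem_range_add_one.1 (List.mem_filter.1 hb).1
    omega
  · intro a ha b hb
    obtain ⟨c, hc, rfl⟩ := List.mem_map.1 hb
    have h1 := mem_range_add_one.1 (List.mem_filter.1 (List.mem_reverse.1 hc)).1
    have := hJm a ha
    omega

theorem IsColumn.sortedLT {k m : ℕ} {q : Fin k → ℕ} (hq : IsColumn k m q) :
    (List.ofFn q).SortedLT := hq.strictMono.sortedLT_ofFn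

theorem xi_colTab {k m : ℕ} {q : Fin k → ℕ} (hq : IsColumn k m q) :
    xi k m (colTab k m q).1 (colTab k m q).2 = List.ofFn q := by
  refine (sortedLT_xi (sortedLT_xiInvJ m hq.sortedLT) fun v hv => (mem_xiInvJ.1 hv).2).eq_of_mem_iff
    hq.sortedLT fun v => ?_
  rw [mem_xi, colTab, mem_xiInvJ]
  constructor
  · rintro (h | ⟨c, hc, h, rfl⟩)
    · exact h.1
    · by_contra hcon
      exact h (mem_xiInvI.2 ⟨hc, hcon⟩)
  · intro hv
    by_cases hvm : v ≤ m
    · exact Or.inl ⟨hv, hvm⟩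
    · obtain ⟨i, rfl⟩ := List.mem_ofFn.1 hv
      have h1 := hq.le i
      refine Or.inr ⟨m + k + 1 - q i, by omega, fun h => (mem_xiInvI.1 h).2 ?_, by omega⟩
      rwa [show m + (k + 1 - (m + k + 1 - q i)) = q i by omega]

theorem wtTab_colTab {k m M : ℕ} {q : Fin k → ℕ} (hq : IsColumn k m q) :
    wtTab k m M (colTab k m q) = colWeight k m M q := by
  rw [wtTab, xi_colTab hq, wtL, Finset.sum_range, colWeight]
  refine Finset.sum_congr rfl fun r _ => ?_
  rw [List.getD_eq_getElem _ _ (by simp), List.getElem_ofFn]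

/-- The entries of a column not exceeding `m` form an initial segment. -/
theorem IsColumn.exists_split {k m : ℕ} {q : Fin k → ℕ} (hq : IsColumn k m q) :
    ∃ h ≤ k, ∀ r : Fin k, q r ≤ m ↔ (r : ℕ) < h := by
  classical
  by_cases hall : ∀ r, q r ≤ m
  · exact ⟨k, le_rfl, fun r => ⟨fun _ => r.isLt, fun _ => hall r⟩⟩
  · have hex : ∃ h, ∃ hk : h < k, ¬ q ⟨h, hk⟩ ≤ m := by
      push Not at hall
      obtain ⟨r, hr⟩ := hall
      exact ⟨r, r.isLt, not_le.2 hr⟩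
    obtain ⟨hk, hm⟩ := Nat.find_spec hex
    refine ⟨Nat.find hex, hk.le, fun r => ⟨fun hr => ?_, fun hr => ?_⟩⟩
    · by_contra hcon
      have : q ⟨Nat.find hex, hk⟩ ≤ q r := hq.strictMono.monotone (Fin.le_def.2 (not_lt.1 hcon))
      omega
    · by_contra hcon
      exact Nat.find_min hex hr ⟨r.isLt, hcon⟩

theorem xiInvJ_eq_ofFn {k m h : ℕ} {q : Fin k → ℕ} (hq : IsColumn k m q) (hk : h ≤ k)
    (hh : ∀ r : Fin k, q r ≤ m ↔ (r : ℕ) < h) :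
    xiInvJ m (List.ofFn q) = List.ofFn fun a : Fin h => q (a.castLE hk) := by
  refine (sortedLT_xiInvJ m hq.sortedLT).eq_of_mem_iff
    (hq.strictMono.comp (Fin.strictMono_castLE hk)).sortedLT_ofFn fun v => ?_
  rw [mem_xiInvJ, List.mem_ofFn, List.mem_ofFn]
  constructor
  · rintro ⟨⟨i, rfl⟩, hv⟩
    exact ⟨⟨i, (hh i).1 hv⟩, rfl⟩
  · rintro ⟨a, rfl⟩
    exact ⟨⟨_, rfl⟩, (hh _).2 a.isLt⟩

/-- Counting the entries of the row sequence of a tableau. -/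
theorem card_filter_xiInvI {k m : ℕ} {q : Fin k → ℕ} (hq : IsColumn k m q) {c : ℕ} (hc : c ≤ k) :
    ((xiInvI k m (List.ofFn q)).toFinset.filter (· ≤ c)).card +
      (Finset.univ.filter fun r => m + k + 1 - c ≤ q r).card = c := by
  classical
  have h1 : ((xiInvI k m (List.ofFn q)).toFinset.filter (· ≤ c)) =
      (Finset.Icc 1 c).filter fun i => m + (k + 1 - i) ∉ List.ofFn q := by
    ext i
    simp only [Finset.mem_filter, List.mem_toFinset, mem_xiInvI, Finset.mem_Icc]
    constructor
    · rintro ⟨⟨h1, h2⟩, h3⟩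
      exact ⟨⟨h1.1, h3⟩, h2⟩
    · rintro ⟨⟨h1, h3⟩, h2⟩
      exact ⟨⟨⟨h1, by omega⟩, h2⟩, h3⟩
  have h2 : (Finset.univ.filter fun r => m + k + 1 - c ≤ q r).card =
      ((Finset.Icc 1 c).filter fun i => ¬ m + (k + 1 - i) ∉ List.ofFn q).card := by
    refine Finset.card_bij (fun r _ => m + k + 1 - q r) ?_ ?_ ?_
    · intro r hr
      have h3 := (Finset.mem_filter.1 hr).2
      have h4 := hq.le r
      rw [Finset.mem_filter, Finset.mem_Icc, not_not,
        show m + (k + 1 - (m + k + 1 - q r)) = q r by omega]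
      exact ⟨by omega, List.mem_ofFn.2 ⟨r, rfl⟩⟩
    · intro r hr r' hr' he
      have h4 := hq.le r
      have h5 := hq.le r'
      exact hq.strictMono.injective (by omega)
    · intro i hi
      obtain ⟨h3, h4⟩ := Finset.mem_filter.1 hi
      rw [Finset.mem_Icc] at h3
      obtain ⟨r, hr⟩ := List.mem_ofFn.1 (not_not.1 h4)
      exact ⟨r, Finset.mem_filter.2 ⟨Finset.mem_univ _, by omega⟩, by omega⟩
  rw [h1, h2, Finset.card_filter_add_card_filter_not]
  simp

theorem length_colTab {k m h : ℕ} {q : Fin k → ℕ} (hq : IsColumn k m q) (hk : h ≤ k)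
    (hh : ∀ r : Fin k, q r ≤ m ↔ (r : ℕ) < h) :
    (colTab k m q).1.length = h ∧ (colTab k m q).2.length = h := by
  refine ⟨?_, by rw [colTab, xiInvJ_eq_ofFn hq hk hh, List.length_ofFn]⟩
  have h1 := card_filter_xiInvI hq (le_refl k)
  have h2 : (xiInvI k m (List.ofFn q)).toFinset.filter (· ≤ k) =
      (xiInvI k m (List.ofFn q)).toFinset :=
    Finset.filter_true_of_mem fun i hi => (mem_xiInvI.1 (List.mem_toFinset.1 hi)).1.2
  have h3 : (Finset.univ.filter fun r => m + k + 1 - k ≤ q r) =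
      Finset.univ.filter fun r : Fin k => ¬ (r : ℕ) < h := by
    refine Finset.filter_congr fun r _ => ?_
    rw [← hh r]
    omega
  have h4 : (Finset.univ.filter fun r : Fin k => (r : ℕ) < h).card = h := by
    rw [Fin.card_filter_val_lt, min_eq_right hk]
  have h5 := Finset.card_filter_add_card_filter_not (s := (Finset.univ : Finset (Fin k)))
    (fun r : Fin k => (r : ℕ) < h)
  rw [Finset.card_fin, h4] at h5
  rw [h2, h3, List.toFinset_card_of_nodup (sortedLT_xiInvI k m _).nodup] at h1
  change (xiInvI k m (List.ofFn q)).length = h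
  omega

theorem isTab_colTab {k m : ℕ} {q : Fin k → ℕ} (hq : IsColumn k m q) (hm : ∃ i, q i ≤ m) :
    isTab k m (colTab k m q).1 (colTab k m q).2 := by
  obtain ⟨h, hk, hh⟩ := hq.exists_split
  obtain ⟨h1, h2⟩ := length_colTab hq hk hh
  refine ⟨h1.trans h2.symm, fun he => ?_, (sortedLT_xiInvI k m _).pairwise.isChain,
    (sortedLT_xiInvJ m hq.sortedLT).pairwise.isChain, fun v hv => (mem_xiInvI.1 hv).1,
    fun v hv => ?_⟩
  · obtain ⟨i, hi⟩ := hm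
    have := (hh i).1 hi
    rw [he, List.length_nil] at h1
    omega
  · obtain ⟨h3, h4⟩ := mem_xiInvJ.1 hv
    obtain ⟨i, rfl⟩ := List.mem_ofFn.1 h3
    exact ⟨hq.one_le i, h4⟩

/-- The minor of a tableau is the maximal minor of the corresponding column. -/
theorem dmin_colTab {k m : ℕ} {q : Fin k → ℕ} (hq : IsColumn k m q) :
    dmin k m (colTab k m q).1 (colTab k m q).2 = maxMinor (genCol k m) q := by
  obtain ⟨h, hk, hh⟩ := hq.exists_split
  obtain ⟨t, rfl⟩ := Nat.exists_eq_add_of_le hk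
  obtain ⟨hI, -⟩ := length_colTab hq hk hh
  have hJ : (colTab (h + t) m q).2 = List.ofFn fun a : Fin h => q (a.castLE hk) :=
    xiInvJ_eq_ofFn hq hk hh
  set I := (colTab (h + t) m q).1 with hIdef
  have hgt (s : Fin t) : m < q (Fin.natAdd h s) := by
    have := (not_congr (hh (Fin.natAdd h s))).2 (by simp)
    omega
  have hle (a : Fin h) : q (Fin.castAdd t a) ≤ m := (hh _).2 a.isLt
  have hImem (a : Fin h) : (1 ≤ I[(a : ℕ)] ∧ I[(a : ℕ)] ≤ h + t) ∧
      m + (h + t + 1 - I[(a : ℕ)]) ∉ List.ofFn q := mem_xiInvI.1 (List.getElem_mem _)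
  set f : Fin h → Fin (h + t) := fun a => ⟨I[(a : ℕ)] - 1, by have := (hImem a).1; omega⟩ with hf
  set g : Fin t → Fin (h + t) := fun s => ⟨m + (h + t) - q (Fin.natAdd h s), by
    have := hgt s; have := hq.le (Fin.natAdd h s); omega⟩ with hg
  have hIs : I.SortedLT := sortedLT_xiInvI _ _ _
  have hfm : StrictMono f := by
    intro a a' haa
    have h1 : I[(a : ℕ)] < I[(a' : ℕ)] := hIs.getElem_lt_getElem_iff.2 haa
    have h2 := (hImem a).1
    rw [Fin.lt_def]
    simp only [hf]
    omega
  have hga : StrictAnti g := by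
    intro s s' hss
    have h1 : q (Fin.natAdd h s) < q (Fin.natAdd h s') := hq.strictMono (by
      rw [Fin.lt_def]; simpa using hss)
    have h2 := hq.le (Fin.natAdd h s')
    rw [Fin.lt_def]
    simp only [hg]
    omega
  have hfg (a : Fin h) (s : Fin t) : f a ≠ g s := by
    intro he
    have h1 := congrArg Fin.val he
    simp only [hf, hg] at h1
    have h2 := (hImem a).1
    have h3 := hgt s
    have h4 := hq.le (Fin.natAdd h s)
    refine (hImem a).2 (List.mem_ofFn.2 ⟨Fin.natAdd h s, ?_⟩)
    omega
  have hdet := det_of_unit_rows t (Matrix.of fun r => genCol (h + t) m (q r)) g f hga hfm hfg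
    (fun s i => by
      have h3 := hgt s
      have h4 := hq.le (Fin.natAdd h s)
      rw [Matrix.of_apply, genCol, dif_neg (by omega)]
      refine if_congr ?_ ?_ rfl
      · rw [Fin.ext_iff]
        simp only [hg]
        omega
      · congr 1
        simp only [hg]
        omega)
  rw [maxMinor, hdet, dmin, ← Matrix.det_transpose, ← Matrix.det_reindex_self (finCongr hI)]
  congr 1
  refine Matrix.ext fun a b => ?_
  have hb := hle a
  have hb1 := hq.one_le (Fin.castAdd t a)
  have h2 := (hImem b).1
  have hJa : (colTab (h + t) m q).2.getD a 0 = q (Fin.castAdd t a) := by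
    rw [hJ, List.getD_eq_getElem _ _ (by simp), List.getElem_ofFn]
    rfl
  have hIb : I.getD b 0 = I[(b : ℕ)] := List.getD_eq_getElem _ _ _
  simp only [Matrix.reindex_apply, Matrix.submatrix_apply, Matrix.transpose_apply, Matrix.of_apply,
    finCongr_symm, finCongr_apply, Fin.val_cast, hJa, hIb]
  rw [dif_pos ⟨by omega, by omega⟩, genCol, dif_pos (by omega)]

theorem getElem_le_of_card {l l' : List ℕ} (hl : l.SortedLT) (hl' : l'.SortedLT) {r : ℕ}
    (hr : r < l.length) (hr' : r < l'.length)
    (h : (l'.toFinset.filter (· ≤ l'[r])).card ≤ (l.toFinset.filter (· ≤ l'[r])).card) :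
    l[r] ≤ l'[r] := by
  by_contra hcon
  have h1 : (l.toFinset.filter (· ≤ l'[r])) ⊆
      (Finset.univ.filter fun i : Fin l.length => (i : ℕ) < r).image l.get := by
    intro v hv
    obtain ⟨h2, h3⟩ := Finset.mem_filter.1 hv
    obtain ⟨i, rfl⟩ := List.mem_iff_get.1 (List.mem_toFinset.1 h2)
    refine Finset.mem_image_of_mem _ (Finset.mem_filter.2 ⟨Finset.mem_univ _, ?_⟩)
    have h4 : l[(i : ℕ)] < l[r] := lt_of_le_of_lt h3 (not_le.1 hcon)
    exact hl.getElem_lt_getElem_iff.1 h4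
  have h2 : (Finset.univ.filter fun i : Fin l'.length => (i : ℕ) < r + 1).image l'.get ⊆
      (l'.toFinset.filter (· ≤ l'[r])) := by
    intro v hv
    obtain ⟨i, hi, rfl⟩ := Finset.mem_image.1 hv
    have hi := (Finset.mem_filter.1 hi).2
    refine Finset.mem_filter.2 ⟨List.mem_toFinset.2 (List.get_mem _ _), ?_⟩
    exact hl'.getElem_le_getElem_iff.2 (by omega : (i : ℕ) ≤ r)
  have h3 := Finset.card_le_card h2
  have h4 := (Finset.card_le_card h1).trans Finset.card_image_le
  rw [Finset.card_image_of_injective _ hl'.strictMono_get.injective, Fin.card_filter_val_lt] at h3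
  rw [Fin.card_filter_val_lt] at h4
  omega

theorem tleq_colTab {k m : ℕ} {x y : Fin k → ℕ} (hx : IsColumn k m x) (hy : IsColumn k m y)
    (hxy : x ≤ y) : tleq (colTab k m x) (colTab k m y) := by
  classical
  obtain ⟨h, hk, hh⟩ := hx.exists_split
  obtain ⟨h', hk', hh'⟩ := hy.exists_split
  obtain ⟨hIx, -⟩ := length_colTab hx hk hh
  obtain ⟨hIy, -⟩ := length_colTab hy hk' hh'
  have hle : h' ≤ h := by
    by_contra hcon
    have h1 := (hh' ⟨h, by omega⟩).2 (not_le.1 hcon)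
    have h2 := (hh ⟨h, by omega⟩).1 ((hxy _).trans h1)
    exact lt_irrefl _ h2
  refine ⟨by omega, fun r hr => ⟨?_, ?_⟩⟩
  · rw [List.getD_eq_getElem _ _ (by omega), List.getD_eq_getElem _ _ hr]
    refine getElem_le_of_card (sortedLT_xiInvI _ _ _) (sortedLT_xiInvI _ _ _) _ _ ?_
    have hc : (xiInvI k m (List.ofFn y))[r]'hr ≤ k := (mem_xiInvI.1 (List.getElem_mem hr)).1.2
    have h1 := card_filter_xiInvI hx hc
    have h2 := card_filter_xiInvI hy hc
    have h3 : (Finset.univ.filter fun i =>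
          m + k + 1 - (xiInvI k m (List.ofFn y))[r]'hr ≤ x i).card ≤
        (Finset.univ.filter fun i => m + k + 1 - (xiInvI k m (List.ofFn y))[r]'hr ≤ y i).card :=
      Finset.card_le_card fun i hi => Finset.mem_filter.2
        ⟨Finset.mem_univ _, (Finset.mem_filter.1 hi).2.trans (hxy i)⟩
    change ((xiInvI k m (List.ofFn y)).toFinset.filter (· ≤ (xiInvI k m (List.ofFn y))[r]'hr)).card ≤
      ((xiInvI k m (List.ofFn x)).toFinset.filter (· ≤ (xiInvI k m (List.ofFn y))[r]'hr)).card
    omega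
  · have hJx : (colTab k m x).2 = _ := xiInvJ_eq_ofFn hx hk hh
    have hJy : (colTab k m y).2 = _ := xiInvJ_eq_ofFn hy hk' hh'
    rw [hJx, hJy, List.getD_eq_getElem _ _ (by simp; omega), List.getD_eq_getElem _ _ (by simp; omega),
      List.getElem_ofFn, List.getElem_ofFn]
    exact hxy _

/-- The condition on columns corresponding to `J ⪰ J̃`. -/
def IsBallot {k : ℕ} (n : ℕ) (q : Fin k → ℕ) : Prop :=
  ∀ r : Fin k, ¬ (q r ≤ 2 * r ∧ q r ≤ 2 * n)

theorem isTabN_colTab {k n : ℕ} {q : Fin k → ℕ} (hq : IsColumn k (2 * n) q) (hb : IsBallot n q)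
    (hm : ∃ i, q i ≤ 2 * n) :
    isTabN k n (colTab k (2 * n) q).1 (colTab k (2 * n) q).2 := by
  obtain ⟨h, hk, hh⟩ := hq.exists_split
  obtain ⟨h1, h2⟩ := length_colTab hq hk hh
  have hn : h ≤ n := by
    by_contra hcon
    have h3 := (hh ⟨n, by omega⟩).2 (not_le.1 hcon)
    exact hb _ ⟨h3, h3⟩
  refine ⟨isTab_colTab hq hm, by rw [h1]; exact le_min hk hn, by rw [h2]; exact hn, fun r hr => ?_⟩
  rw [h2] at hr
  have hJ : (colTab k (2 * n) q).2 = _ := xiInvJ_eq_ofFn hq hk hh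
  rw [hJ, List.getD_eq_getElem _ _ (by simpa using hr), List.getElem_ofFn]
  have h3 := hb ⟨r, by omega⟩
  have h4 := (hh ⟨r, by omega⟩).2 hr
  change 2 * r + 1 ≤ q ⟨r, by omega⟩
  have h5 : ((⟨r, by omega⟩ : Fin k) : ℕ) = r := rfl
  omega

theorem length_xi {k m : ℕ} {I J : List ℕ} (h : isTab k m I J) : (xi k m I J).length = k := by
  obtain ⟨hIJ, -, hI, -, hIk, -⟩ := h
  have h1 : ((List.range k).map (· + 1)).filter (fun c => decide (c ∈ I)) = I := by
    refine ((sortedLT_range_add_one k).pairwise.filter _).sortedLT.eq_of_mem_iff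
      (List.isChain_iff_pairwise.1 hI).sortedLT fun v => ?_
    rw [List.mem_filter, mem_range_add_one, decide_eq_true_iff]
    exact ⟨fun h => h.2, fun h => ⟨hIk v h, h⟩⟩
  have h2 := List.length_eq_length_filter_add (l := (List.range k).map (· + 1))
    (fun c => decide (c ∈ I))
  rw [h1] at h2
  simp only [List.length_map, List.length_range] at h2
  rw [xi, List.length_append, List.length_map, List.length_reverse, ← hIJ]
  refine Eq.trans ?_ h2.symm
  congr 3
  ext c
  simp

/-- Every one-line tableau corresponds to a column. -/
theorem exists_column {k m : ℕ} {A : List ℕ × List ℕ} (hA : isTab k m A.1 A.2) :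
    ∃ q : Fin k → ℕ, IsColumn k m q ∧ (∃ i, q i ≤ m) ∧ xi k m A.1 A.2 = List.ofFn q ∧
      colTab k m q = A := by
  have hlen := length_xi hA
  obtain ⟨hIJ, hne, hI, hJ, hIk, hJm⟩ := hA
  have hJs : A.2.SortedLT := (List.isChain_iff_pairwise.1 hJ).sortedLT
  have hIs : A.1.SortedLT := (List.isChain_iff_pairwise.1 hI).sortedLT
  have hs := sortedLT_xi (k := k) (I := A.1) hJs fun v hv => (hJm v hv).2
  set q : Fin k → ℕ := fun r => (xi k m A.1 A.2).get (r.cast hlen.symm) with hq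
  have hofFn : xi k m A.1 A.2 = List.ofFn q :=
    List.ext_getElem (by simp [hlen]) (by simp [hq])
  have hmem (i : Fin k) : q i ∈ xi k m A.1 A.2 := List.get_mem _ _
  have hcol : IsColumn k m q := by
    have key (i : Fin k) : 1 ≤ q i ∧ q i ≤ m + k := by
      rcases mem_xi.1 (hmem i) with h | ⟨c, hc, -, h⟩
      · have := hJm _ h
        omega
      · omega
    exact ⟨fun i j hij => hs.strictMono_get hij, fun i => (key i).1, fun i => (key i).2⟩
  refine ⟨q, hcol, ?_, hofFn, ?_⟩
  · obtain ⟨v, hv⟩ := List.exists_mem_of_ne_nil A.2 (by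
      rintro he
      rw [he, List.length_nil] at hIJ
      exact hne (List.eq_nil_of_length_eq_zero hIJ))
    have h1 : v ∈ List.ofFn q := hofFn ▸ mem_xi.2 (Or.inl hv)
    obtain ⟨i, rfl⟩ := List.mem_ofFn.1 h1
    exact ⟨i, (hJm _ hv).2⟩
  · rw [colTab, ← hofFn]
    refine Prod.ext ?_ ?_
    · refine (sortedLT_xiInvI _ _ _).eq_of_mem_iff hIs fun v => ?_
      rw [mem_xiInvI, mem_xi]
      constructor
      · rintro ⟨h1, h2⟩
        by_contra hcon
        exact h2 (Or.inr ⟨v, h1, hcon, rfl⟩)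
      · intro hv
        have h1 := hIk v hv
        refine ⟨h1, ?_⟩
        rintro (h2 | ⟨c, hc, hcI, he⟩)
        · have := (hJm _ h2).2
          omega
        · have : c = v := by omega
          exact hcI (this ▸ hv)
    · refine (sortedLT_xiInvJ _ hs).eq_of_mem_iff hJs fun v => ?_
      rw [mem_xiInvJ, mem_xi]
      constructor
      · rintro ⟨h1 | ⟨c, hc, -, rfl⟩, h2⟩
        · exact h1
        · omega
      · intro hv
        exact ⟨Or.inl hv, (hJm v hv).2⟩

theorem exists_ballot_column {k n : ℕ} {A : List ℕ × List ℕ} (hA : isTabN k n A.1 A.2) :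
    ∃ q : Fin k → ℕ, IsColumn k (2 * n) q ∧ (∃ i, q i ≤ 2 * n) ∧ IsBallot n q ∧
      xi k (2 * n) A.1 A.2 = List.ofFn q ∧ colTab k (2 * n) q = A := by
  obtain ⟨q, hq, hm, hxi, rfl⟩ := exists_column hA.1
  refine ⟨q, hq, hm, fun r hr => ?_, hxi, rfl⟩
  obtain ⟨h, hk, hh⟩ := hq.exists_split
  obtain ⟨-, h2⟩ := length_colTab hq hk hh
  have hrh := (hh r).1 hr.2
  have h3 := hA.2.2.2 r (by omega)
  have hJ : (colTab k (2 * n) q).2 = _ := xiInvJ_eq_ofFn hq hk hh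
  rw [hJ, List.getD_eq_getElem _ _ (by simpa using hrh), List.getElem_ofFn] at h3
  change 2 * (r : ℕ) + 1 ≤ q r at h3
  omega

theorem zipWith_ofFn {k : ℕ} (f : ℕ → ℕ → ℕ) (a b : Fin k → ℕ) :
    List.zipWith f (List.ofFn a) (List.ofFn b) = List.ofFn fun i => f (a i) (b i) :=
  List.ext_getElem (by simp) (by simp)

theorem maxMinor_top {k m : ℕ} {q : Fin k → ℕ} (hq : IsColumn k m q) (hm : ¬ ∃ i, q i ≤ m) :
    maxMinor (genCol k m) q = 1 := by
  obtain ⟨hI, -⟩ := length_colTab (h := 0) hq (Nat.zero_le k)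
    fun r => ⟨fun h => absurd ⟨r, h⟩ hm, fun h => absurd h (Nat.not_lt_zero _)⟩
  rw [← dmin_colTab hq, List.eq_nil_of_length_eq_zero hI]
  exact Matrix.det_fin_zero

theorem colWeight_top {k m M : ℕ} {q : Fin k → ℕ} (hq : IsColumn k m q) (hm : ¬ ∃ i, q i ≤ m) :
    colWeight k m M q = 0 := by
  refine Finset.sum_eq_zero fun r _ => ?_
  have h1 (r : Fin k) : m < q r := not_le.1 fun h => hm ⟨r, h⟩
  have h2 : m + (r + 1) ≤ q r := by
    obtain ⟨r, hr⟩ := r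
    induction r with
    | zero => exact h1 _
    | succ r ih =>
      have h4 : m + (r + 1) ≤ q ⟨r, by omega⟩ := ih (by omega) (Finset.mem_univ _)
      have h3 : q ⟨r, by omega⟩ < q ⟨r + 1, hr⟩ := hq.strictMono (by simp [Fin.lt_def])
      change m + (r + 1 + 1) ≤ _
      omega
  rw [Nat.sub_eq_zero_of_le h2, zero_mul]

end Dictionary

section Quotient

/-- The coordinate ring of the nullcone. -/
abbrev NullconeRing (k n : ℕ) : Type := MvPolynomial (Fin k × Fin (2 * n)) ℂ ⧸ sympIdeal k n

/-- The image of a maximal minor in the coordinate ring of the nullcone. -/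
def nullMinor (k n : ℕ) (q : Fin k → ℕ) : NullconeRing k n :=
  Ideal.Quotient.mk (sympIdeal k n) (maxMinor (genCol k (2 * n)) q)

theorem rbase_mem (k n : ℕ) (i j : Fin k) : rbase k n i j ∈ sympIdeal k n := by
  rcases lt_trichotomy i j with h | rfl | h
  · exact Ideal.subset_span ⟨i, j, h, rfl⟩
  · have : rbase k n i i = 0 := Finset.sum_eq_zero fun u _ => sub_self _
    rw [this]
    exact zero_mem _
  · have h1 : rbase k n i j = -rbase k n j i := by
      rw [rbase, rbase, ← Finset.sum_neg_distrib]
      exact Finset.sum_congr rfl fun u _ => (neg_sub _ _).symm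
    rw [h1]
    exact neg_mem (Ideal.subset_span ⟨j, i, h, rfl⟩)

theorem nullcone_relation (k n : ℕ) (i j : Fin k) :
    ∑ u ∈ Finset.range n,
      (Ideal.Quotient.mk (sympIdeal k n) (genCol k (2 * n) (2 * u + 1) i) *
          Ideal.Quotient.mk (sympIdeal k n) (genCol k (2 * n) (2 * u + 2) j) -
        Ideal.Quotient.mk (sympIdeal k n) (genCol k (2 * n) (2 * u + 1) j) *
          Ideal.Quotient.mk (sympIdeal k n) (genCol k (2 * n) (2 * u + 2) i)) = 0 := by
  have h := Ideal.Quotient.eq_zero_iff_mem.2 (rbase_mem k n i j)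
  rw [← h, rbase, map_sum, Finset.sum_range]
  refine Finset.sum_congr rfl fun u _ => ?_
  have hu := u.isLt
  have h1 (i : Fin k) : genCol k (2 * n) (2 * u + 1) i =
      MvPolynomial.X (i, ⟨2 * u.1, by omega⟩) := dif_pos (by omega)
  have h2 (i : Fin k) : genCol k (2 * n) (2 * u + 2) i =
      MvPolynomial.X (i, ⟨2 * u.1 + 1, by omega⟩) := dif_pos (by omega)
  rw [h1, h1, h2, h2, map_sub, map_mul, map_mul]

theorem nullMinor_mem_of_not_ballot {k n M : ℕ} (hM : 2 * (2 * n) < M) {q : Fin k → ℕ}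
    (hq : IsColumn k (2 * n) q) (hb : ¬ IsBallot n q) :
    nullMinor k n q ∈ Submodule.span ℂ {z | ∃ x, IsColumn k (2 * n) x ∧
      colWeight k (2 * n) M x < colWeight k (2 * n) M q ∧ (∃ i, x i ≤ 2 * n) ∧
      z = nullMinor k n x} := by
  rw [IsBallot] at hb
  push Not at hb
  obtain ⟨r, hr⟩ := hb
  have h := exists_lower_of_not_ballot hM
    (fun a i => Ideal.Quotient.mk (sympIdeal k n) (genCol k (2 * n) a i))
    (nullcone_relation k n) hq r hr
  simpa only [nullMinor, map_maxMinor] using h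

/-- Products of two standardly ordered maximal minors of total weight below `w`. -/
def standardProducts (k n M w : ℕ) : Set (NullconeRing k n) :=
  {z | ∃ x y, IsColumn k (2 * n) x ∧ IsColumn k (2 * n) y ∧ IsBallot n x ∧ IsBallot n y ∧ x ≤ y ∧
    (∃ i, x i ≤ 2 * n) ∧ colWeight k (2 * n) M x + colWeight k (2 * n) M y < w ∧
    z = nullMinor k n x * nullMinor k n y}

theorem span_standardProducts_mono {k n M w w' : ℕ} (h : w ≤ w') :
    Submodule.span ℂ (standardProducts k n M w) ≤
      Submodule.span ℂ (standardProducts k n M w') := by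
  refine Submodule.span_mono ?_
  rintro z ⟨x, y, h1, h2, h3, h4, h5, h6, h7, h8⟩
  exact ⟨x, y, h1, h2, h3, h4, h5, h6, h7.trans_le h, h8⟩

theorem IsColumn.inf {k m : ℕ} {a b : Fin k → ℕ} (ha : IsColumn k m a) (hb : IsColumn k m b) :
    IsColumn k m (a ⊓ b) :=
  ⟨fun _ _ h => min_lt_min (ha.strictMono h) (hb.strictMono h),
    fun i => le_inf (ha.one_le i) (hb.one_le i), fun i => inf_le_left.trans (ha.le i)⟩

theorem IsColumn.sup {k m : ℕ} {a b : Fin k → ℕ} (ha : IsColumn k m a) (hb : IsColumn k m b) :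
    IsColumn k m (a ⊔ b) :=
  ⟨fun _ _ h => max_lt_max (ha.strictMono h) (hb.strictMono h),
    fun i => le_sup_of_le_left (ha.one_le i), fun i => sup_le (ha.le i) (hb.le i)⟩

theorem colWeight_inf_add_sup {k m M : ℕ} (a b : Fin k → ℕ) :
    colWeight k m M (a ⊓ b) + colWeight k m M (a ⊔ b) = colWeight k m M a + colWeight k m M b :=
  colWeight_add_congr fun i => by
    rcases le_total (a i) (b i) with h | h
    · exact Or.inl ⟨inf_eq_left.2 h, sup_eq_right.2 h⟩
    · exact Or.inr ⟨inf_eq_right.2 h, sup_eq_left.2 h⟩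

theorem straighten_mod {k n M w : ℕ} (hM : 2 * (2 * n) < M) {a b : Fin k → ℕ}
    (ha : IsColumn k (2 * n) a) (hb : IsColumn k (2 * n) b)
    (hab : (∃ i, a i ≤ 2 * n) ∨ ∃ i, b i ≤ 2 * n)
    (hw : colWeight k (2 * n) M a + colWeight k (2 * n) M b = w)
    (ih : ∀ x y : Fin k → ℕ, IsColumn k (2 * n) x → IsColumn k (2 * n) y →
      ((∃ i, x i ≤ 2 * n) ∨ ∃ i, y i ≤ 2 * n) →
      colWeight k (2 * n) M x + colWeight k (2 * n) M y < w →
      nullMinor k n x * nullMinor k n y ∈ Submodule.span ℂ (standardProducts k n M w)) :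
    nullMinor k n a * nullMinor k n b - nullMinor k n (a ⊓ b) * nullMinor k n (a ⊔ b) ∈
      Submodule.span ℂ (standardProducts k n M w) := by
  have h := straighten hM (genCol k (2 * n)) ha hb hab
  rw [hw] at h
  have hle : Submodule.span ℂ (lowerProducts (2 * n) M (genCol k (2 * n)) w) ≤
      (Submodule.span ℂ (standardProducts k n M w)).comap
        (Ideal.Quotient.mkₐ ℂ (sympIdeal k n)).toLinearMap := by
    refine Submodule.span_le.2 ?_
    rintro _ ⟨x, y, hx, hy, hxy, hlt, rfl⟩
    have := ih x y hx hy hxy hlt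
    rw [nullMinor, nullMinor, ← map_mul] at this
    exact this
  have h2 := hle h
  simp only [nullMinor, ← map_mul, ← map_sub]
  exact h2

theorem mul_mem_standard {k n M : ℕ} (hM : 2 * (2 * n) < M) : ∀ (w : ℕ) (a b : Fin k → ℕ),
    IsColumn k (2 * n) a → IsColumn k (2 * n) b → ((∃ i, a i ≤ 2 * n) ∨ ∃ i, b i ≤ 2 * n) →
    colWeight k (2 * n) M a + colWeight k (2 * n) M b < w →
    nullMinor k n a * nullMinor k n b ∈ Submodule.span ℂ (standardProducts k n M w) := by
  intro w
  induction w with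
  | zero => intro a b _ _ _ h; exact absurd h (Nat.not_lt_zero _)
  | succ w ih =>
    intro a b ha hb hab hlt
    rcases (Nat.lt_succ_iff.1 hlt).lt_or_eq with hlt | hw
    · exact span_standardProducts_mono w.le_succ (ih a b ha hb hab hlt)
    have hmod := span_standardProducts_mono w.le_succ (straighten_mod hM ha hb hab hw ih)
    rw [← sub_add_cancel (nullMinor k n a * nullMinor k n b)
      (nullMinor k n (a ⊓ b) * nullMinor k n (a ⊔ b))]
    refine add_mem hmod ?_
    have hinf := ha.inf hb
    have hsup := ha.sup hb
    have hsum := (colWeight_inf_add_sup (m := 2 * n) (M := M) a b).trans hw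
    have hlow : ∃ i, (a ⊓ b) i ≤ 2 * n := by
      rcases hab with ⟨i, hi⟩ | ⟨i, hi⟩
      · exact ⟨i, inf_le_left.trans hi⟩
      · exact ⟨i, inf_le_right.trans hi⟩
    by_cases h1 : IsBallot n (a ⊓ b)
    · by_cases h2 : IsBallot n (a ⊔ b)
      · exact Submodule.subset_span ⟨_, _, hinf, hsup, h1, h2, inf_le_sup, hlow, by omega, rfl⟩
      · refine span_mul_left_le _ _ _ ?_ (nullMinor_mem_of_not_ballot hM hsup h2)
        rintro _ ⟨y, hy, hlt, -, rfl⟩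
        exact span_standardProducts_mono w.le_succ (ih _ _ hinf hy (Or.inl hlow) (by omega))
    · rw [mul_comm (nullMinor k n (a ⊓ b))]
      refine span_mul_left_le _ _ _ ?_ (nullMinor_mem_of_not_ballot hM hinf h1)
      rintro _ ⟨x, hx, hlt, hxm, rfl⟩
      exact span_standardProducts_mono w.le_succ (ih _ _ hsup hx (Or.inr hxm) (by omega))

open Classical in
/-- The tableau of a column, absent for the top column. -/
def optTab (k m : ℕ) (q : Fin k → ℕ) : Option (List ℕ × List ℕ) :=
  if ∃ i, q i ≤ m then some (colTab k m q) else none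

theorem mk_dmin_colTab {k n : ℕ} {q : Fin k → ℕ} (hq : IsColumn k (2 * n) q) :
    Ideal.Quotient.mk (sympIdeal k n) (dmin k (2 * n) (colTab k (2 * n) q).1
      (colTab k (2 * n) q).2) = nullMinor k n q := by
  rw [dmin_colTab hq, nullMinor]

theorem optTab_elim_minor {k n : ℕ} {q : Fin k → ℕ} (hq : IsColumn k (2 * n) q) :
    (optTab k (2 * n) q).elim 1
      (fun y => Ideal.Quotient.mk (sympIdeal k n) (dmin k (2 * n) y.1 y.2)) = nullMinor k n q := by
  by_cases h : ∃ i, q i ≤ 2 * n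
  · rw [optTab, if_pos h, Option.elim_some, mk_dmin_colTab hq]
  · rw [optTab, if_neg h, Option.elim_none, nullMinor, maxMinor_top hq h, map_one]

theorem optTab_elim_weight {k m M : ℕ} {q : Fin k → ℕ} (hq : IsColumn k m q) :
    (optTab k m q).elim 0 (wtTab k m M) = colWeight k m M q := by
  by_cases h : ∃ i, q i ≤ m
  · rw [optTab, if_pos h, Option.elim_some, wtTab_colTab hq]
  · rw [optTab, if_neg h, Option.elim_none, colWeight_top hq h]

theorem optTab_elim_standard {k n : ℕ} {x y : Fin k → ℕ} (hx : IsColumn k (2 * n) x)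
    (hy : IsColumn k (2 * n) y) (hb : IsBallot n y) (hxy : x ≤ y) :
    (optTab k (2 * n) y).elim True
      (fun t => isTabN k n t.1 t.2 ∧ tleq (colTab k (2 * n) x) t) := by
  by_cases h : ∃ i, y i ≤ 2 * n
  · rw [optTab, if_pos h, Option.elim_some]
    exact ⟨isTabN_colTab hy hb h, tleq_colTab hx hy hxy⟩
  · rw [optTab, if_neg h, Option.elim_none]
    trivial

end Quotient

/-- Proposition `Nwt`. For `A, B ∈ D(𝒩)`, in
`R(𝒩_{k,2n}) = ℂ[M_{k,2n}]/I` the product `δ_A δ_B` is a linear combination of (images of)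
`𝒩`-standard monomials `δ_X δ_Y` with `X ⪯ Y` (the factor `δ_Y` possibly absent), in which
`δ_{A∧B} δ_{A∨B}` appears with coefficient `1`; moreover
`wt(A) + wt(B) ≥ wt(X_r) + wt(Y_r)`, with equality only for `(X_r,Y_r) = (A∧B, A∨B)`. -/
theorem nullcone_straightening_with_weights (k n M : ℕ) (hk : 0 < k) (hn : 0 < n)
    (hM : 2 * (k + 2 * n) < M) (A B : List ℕ × List ℕ)
    (hA : isTabN k n A.1 A.2) (hB : isTabN k n B.1 B.2) :
    ∃ (u : ℕ) (c : Fin u → ℂ) (X : Fin u → List ℕ × List ℕ)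
      (Y : Fin u → Option (List ℕ × List ℕ)),
      (Ideal.Quotient.mk (sympIdeal k n) (dmin k (2 * n) A.1 A.2) *
          Ideal.Quotient.mk (sympIdeal k n) (dmin k (2 * n) B.1 B.2) =
        ∑ r, c r • (Ideal.Quotient.mk (sympIdeal k n) (dmin k (2 * n) (X r).1 (X r).2) *
          (Y r).elim 1 (fun y => Ideal.Quotient.mk (sympIdeal k n) (dmin k (2 * n) y.1 y.2)))) ∧
      (∀ r, isTabN k n (X r).1 (X r).2 ∧
        (Y r).elim True (fun y => isTabN k n y.1 y.2 ∧ tleq (X r) y)) ∧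
      (∃ r0, c r0 = 1 ∧ X r0 = tabMeet k (2 * n) A B ∧
        Y r0 = some (tabJoin k (2 * n) A B) ∧
        ∀ r, r ≠ r0 →
          ¬(X r = tabMeet k (2 * n) A B ∧ Y r = some (tabJoin k (2 * n) A B))) ∧
      ∀ r, wtTab k (2 * n) M (X r) + (Y r).elim 0 (wtTab k (2 * n) M) ≤
          wtTab k (2 * n) M A + wtTab k (2 * n) M B ∧
        (wtTab k (2 * n) M (X r) + (Y r).elim 0 (wtTab k (2 * n) M) =
            wtTab k (2 * n) M A + wtTab k (2 * n) M B →
          X r = tabMeet k (2 * n) A B ∧ Y r = some (tabJoin k (2 * n) A B)) := by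
  obtain ⟨a, ha, ham, hab, hxa, rfl⟩ := exists_ballot_column hA
  obtain ⟨b, hb, hbm, hbb, hxb, rfl⟩ := exists_ballot_column hB
  have hM' : 2 * (2 * n) < M := by omega
  have hmeet : tabMeet k (2 * n) (colTab k (2 * n) a) (colTab k (2 * n) b) =
      colTab k (2 * n) (a ⊓ b) := by
    rw [tabMeet, hxa, hxb, zipWith_ofFn]
    rfl
  have hjoin : tabJoin k (2 * n) (colTab k (2 * n) a) (colTab k (2 * n) b) =
      colTab k (2 * n) (a ⊔ b) := by
    rw [tabJoin, hxa, hxb, zipWith_ofFn]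
    rfl
  have hinf := ha.inf hb
  have hsup := ha.sup hb
  have hinfm : ∃ i, (a ⊓ b) i ≤ 2 * n := ham.imp fun i hi => inf_le_left.trans hi
  have hsupm : ∃ i, (a ⊔ b) i ≤ 2 * n := by
    obtain ⟨i, hi⟩ := ham
    obtain ⟨j, hj⟩ := hbm
    exact ⟨i ⊓ j, sup_le ((ha.strictMono.monotone inf_le_left).trans hi)
      ((hb.strictMono.monotone inf_le_right).trans hj)⟩
  have hinfb : IsBallot n (a ⊓ b) := by
    intro r hr
    rcases le_total (a r) (b r) with h | h
    · rw [Pi.inf_apply, inf_eq_left.2 h] at hr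
      exact hab r hr
    · rw [Pi.inf_apply, inf_eq_right.2 h] at hr
      exact hbb r hr
  have hsupb : IsBallot n (a ⊔ b) := fun r hr =>
    hab r ⟨le_sup_left.trans hr.1, le_sup_left.trans hr.2⟩
  have hsum := colWeight_inf_add_sup (m := 2 * n) (M := M) a b
  have hmem := straighten_mod hM' ha hb (Or.inl ham) rfl
    fun x y hx hy hxy hlt => mul_mem_standard hM' _ x y hx hy hxy hlt
  obtain ⟨N, f, z, hz⟩ := Submodule.mem_span_set'.1 hmem
  choose x y hx hy hxb' hyb' hxy hxm hlt hxyz using fun i => (z i).2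
  have hjoin' : optTab k (2 * n) (a ⊔ b) = some (colTab k (2 * n) (a ⊔ b)) := if_pos hsupm
  rw [hmeet, hjoin, ← hjoin', wtTab_colTab ha, wtTab_colTab hb, ← hsum]
  rw [← hsum] at hlt
  refine ⟨N + 1, Fin.cons 1 f, fun r => colTab k (2 * n) (Fin.cons (α := fun _ => Fin k → ℕ)
    (a ⊓ b) x r), fun r => optTab k (2 * n) (Fin.cons (α := fun _ => Fin k → ℕ) (a ⊔ b) y r),
    ?_, ?_, ⟨0, rfl, rfl, rfl, ?_⟩, ?_⟩
  · rw [Fin.sum_univ_succ]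
    simp only [Fin.cons_zero, Fin.cons_succ]
    simp only [mk_dmin_colTab ha, mk_dmin_colTab hb, mk_dmin_colTab hinf, optTab_elim_minor hsup,
      mk_dmin_colTab (hx _), optTab_elim_minor (hy _), one_smul, ← hxyz]
    rw [hz, add_sub_cancel]
  · intro r
    cases r using Fin.cases with
    | zero => exact ⟨isTabN_colTab hinf hinfb hinfm, optTab_elim_standard hinf hsup hsupb inf_le_sup⟩
    | succ i =>
      exact ⟨isTabN_colTab (hx i) (hxb' i) (hxm i),
        optTab_elim_standard (hx i) (hy i) (hyb' i) (hxy i)⟩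
  · intro r hr
    cases r using Fin.cases with
    | zero => exact absurd rfl hr
    | succ i =>
      rintro ⟨h1, h2⟩
      have h3 := congrArg (wtTab k (2 * n) M) h1
      have h4 := congrArg (fun t => t.elim 0 (wtTab k (2 * n) M)) h2
      simp only [Fin.cons_succ, wtTab_colTab (hx i), wtTab_colTab hinf, optTab_elim_weight (hy i),
        optTab_elim_weight hsup] at h3 h4
      have := hlt i
      omega
  · intro r
    cases r using Fin.cases with
    | zero =>
      simp only [Fin.cons_zero, wtTab_colTab hinf, optTab_elim_weight hsup]
      exact ⟨le_rfl, fun _ => ⟨trivial, trivial⟩⟩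
    | succ i =>
      simp only [Fin.cons_succ, wtTab_colTab (hx i), optTab_elim_weight (hy i)]
      exact ⟨(hlt i).le, fun h => absurd h (hlt i).ne⟩

end
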